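/- Let x̄ ∈ S(v̄,p̄,q̄) and assume (A1)–(A4), with ℛ the threshold of prox-regularity of g at (x̄,p̄) for v̂. Suppose in addition that f is locally strongly monotone in x around (x̄,p̄,q̄) with modulus σ > ℛ. Then for every r ∈ (ℛ,σ) there exists η > 0 such that for every (u,p,v) ∈ gph ∂_x g with ‖u−x̄‖ ≤ η, d₁(p,p̄) ≤ η, ‖v−v̂‖ ≤ η one has ⟨∇_x f(x̄,p̄,q̄)w, w⟩ + ⟨z, w⟩ ≥ (σ−r)‖w‖² for all w ∈ X and all z ∈ D̂*(∂g_p)(u,v)(w); consequently x̄ is a Hölderian fully stable solution corresponding to (v̄,p̄,q̄). -/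

import Mathlib

noncomputable section

open Filter Topology Metric Set MeasureTheory
open scoped RealInnerProductSpace Pointwise

namespace PVS

variable {X : Type*} [NormedAddCommGroup X] [InnerProductSpace ℝ X]
variable {Y : Type*} [NormedAddCommGroup Y] [InnerProductSpace ℝ Y]
variable {W : Type*} [NormedAddCommGroup W] [InnerProductSpace ℝ W]
variable {P : Type*} [MetricSpace P]
variable {Q : Type*} [MetricSpace Q]

/-- Regular (Fréchet) subdifferential of an extended-real-valued function. -/
def regSubdiff (h : X → EReal) (x : X) : Set X :=
  {v | h x ≠ ⊤ ∧ h x ≠ ⊥ ∧ ∀ ε > (0:ℝ), ∀ᶠ u in 𝓝 x,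
      h x + ((⟪v, u - x⟫ - ε * ‖u - x‖ : ℝ) : EReal) ≤ h u}

/-- Weak sequential convergence in an inner product space. -/
def WeakTendsto (xs : ℕ → X) (x : X) : Prop :=
  ∀ z : X, Tendsto (fun k => ⟪xs k, z⟫) atTop (𝓝 ⟪x, z⟫)

/-- Limiting (Mordukhovich) subdifferential. -/
def limSubdiff (h : X → EReal) (x : X) : Set X :=
  {v | ∃ xs vs : ℕ → X, Tendsto xs atTop (𝓝 x) ∧
      Tendsto (fun k => h (xs k)) atTop (𝓝 (h x)) ∧
      (∀ k, vs k ∈ regSubdiff h (xs k)) ∧ WeakTendsto vs v}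

/-- Partial limiting subdifferential with respect to the first variable. -/
def pSubdiff {PP : Type*} (g : X → PP → EReal) (x : X) (p : PP) : Set X :=
  limSubdiff (fun x' => g x' p) x

/-- Graph of a set-valued map. -/
def gph (F : X → Set Y) : Set (X × Y) := {t | t.2 ∈ F t.1}

/-- Regular normal cone. -/
def regNC (Ω : Set X) (x : X) : Set X :=
  {v | ∀ ε > (0:ℝ), ∀ᶠ y in 𝓝[Ω] x, ⟪v, y - x⟫ ≤ ε * ‖y - x‖}

/-- Limiting normal cone. -/
def limNC (Ω : Set X) (x : X) : Set X :=
  {v | ∃ xs vs : ℕ → X, (∀ k, xs k ∈ Ω) ∧ Tendsto xs atTop (𝓝 x) ∧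
      (∀ k, vs k ∈ regNC Ω (xs k)) ∧ Tendsto vs atTop (𝓝 v)}

/-- Regular normal cone to a subset of a product of two inner product spaces,
with the Euclidean product norm. -/
def regNC2 (Ω : Set (X × Y)) (ω : X × Y) : Set (X × Y) :=
  {ζ | ∀ ε > (0:ℝ), ∀ᶠ y in 𝓝[Ω] ω,
      ⟪ζ.1, y.1 - ω.1⟫ + ⟪ζ.2, y.2 - ω.2⟫
        ≤ ε * Real.sqrt (‖y.1 - ω.1‖ ^ 2 + ‖y.2 - ω.2‖ ^ 2)}

/-- Limiting normal cone in a product of two spaces. -/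
def limNC2 (Ω : Set (X × Y)) (ω : X × Y) : Set (X × Y) :=
  {ζ | ∃ ωs ζs : ℕ → X × Y, (∀ k, ωs k ∈ Ω) ∧ Tendsto ωs atTop (𝓝 ω) ∧
      (∀ k, ζs k ∈ regNC2 Ω (ωs k)) ∧ Tendsto ζs atTop (𝓝 ζ)}

/-- Regular coderivative of a set-valued map. -/
def regCoderiv (F : X → Set Y) (u : X) (v : Y) (w : Y) : Set X :=
  {z | (z, -w) ∈ regNC2 (gph F) (u, v)}

/-- Limiting coderivative of a set-valued map. -/
def limCoderiv (F : X → Set Y) (u : X) (v : Y) (w : Y) : Set X :=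
  {z | (z, -w) ∈ limNC2 (gph F) (u, v)}

/-- Regular normal cone in a product of three inner product spaces. -/
def regNC3 (Ω : Set (X × W × Y)) (ω : X × W × Y) : Set (X × W × Y) :=
  {ζ | ∀ ε > (0:ℝ), ∀ᶠ y in 𝓝[Ω] ω,
      ⟪ζ.1, y.1 - ω.1⟫ + ⟪ζ.2.1, y.2.1 - ω.2.1⟫ + ⟪ζ.2.2, y.2.2 - ω.2.2⟫
        ≤ ε * Real.sqrt (‖y.1 - ω.1‖ ^ 2 + ‖y.2.1 - ω.2.1‖ ^ 2 + ‖y.2.2 - ω.2.2‖ ^ 2)}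

/-- Limiting normal cone in a product of three inner product spaces. -/
def limNC3 (Ω : Set (X × W × Y)) (ω : X × W × Y) : Set (X × W × Y) :=
  {ζ | ∃ ωs ζs : ℕ → X × W × Y, (∀ k, ωs k ∈ Ω) ∧ Tendsto ωs atTop (𝓝 ω) ∧
      (∀ k, ζs k ∈ regNC3 Ω (ωs k)) ∧ Tendsto ζs atTop (𝓝 ζ)}

/-- Limiting coderivative of the full partial subdifferential map (x,p) ↦ ∂ₓ g(x,p). -/
def limCoderivFull (g : X → W → EReal) (xb : X) (pb : W) (vh : X) (w : X) : Set (X × W) :=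
  {zs | (zs.1, zs.2, -w) ∈ limNC3 {t : X × W × X | t.2.2 ∈ pSubdiff g t.1 t.2.1} (xb, pb, vh)}

/-- Lipschitz-like (Aubin) property of a set-valued map around a graph point. -/
def LipschitzLike {α Z : Type*} [MetricSpace α] [SeminormedAddCommGroup Z]
    (F : α → Set Z) (ab : α) (zb : Z) : Prop :=
  ∃ ℓ > (0:ℝ), ∃ U ∈ 𝓝 ab, ∃ V ∈ 𝓝 zb,
    ∀ a ∈ U, ∀ a' ∈ U, ∀ z ∈ F a ∩ V, ∃ z' ∈ F a', ‖z - z'‖ ≤ ℓ * dist a a'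

/-- Epigraph of g(·,p). -/
def epi {PP : Type*} (g : X → PP → EReal) (p : PP) : Set (X × ℝ) :=
  {q | g q.1 p ≤ (q.2 : EReal)}

/-- (A1): Lipschitz continuity of the base around the reference point. -/
def A1 (f : X → P → Q → X) (xb : X) (pb : P) (qb : Q) : Prop :=
  ∃ L > (0:ℝ), ∃ ε > (0:ℝ), ∀ x₁ x₂ p₁ p₂ q₁ q₂,
    ‖x₁ - xb‖ < ε → ‖x₂ - xb‖ < ε → dist p₁ pb < ε → dist p₂ pb < ε →
    dist q₁ qb < ε → dist q₂ qb < ε →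
    ‖f x₁ p₁ q₁ - f x₂ p₂ q₂‖ ≤ L * (‖x₁ - x₂‖ + dist p₁ p₂ + dist q₁ q₂)

/-- Parametric prox-regularity with prox-parameter r. -/
def ProxRegWith (g : X → P → EReal) (xb : X) (pb : P) (vh : X) (r : ℝ) : Prop :=
  ∃ ε > (0:ℝ), ∀ x u p v, ‖x - xb‖ < ε → ‖u - xb‖ < ε → dist p pb < ε → ‖v - vh‖ < ε →
    v ∈ pSubdiff g u p →
    g u p + ((⟪v, x - u⟫ - r / 2 * ‖x - u‖ ^ 2 : ℝ) : EReal) ≤ g x p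

/-- Subdifferential continuity with compatible parameterization. -/
def SubdiffCont (g : X → P → EReal) (xb : X) (pb : P) (vh : X) : Prop :=
  Tendsto (fun t : X × P × X => g t.1 t.2.1)
    (𝓝[{t : X × P × X | t.2.2 ∈ pSubdiff g t.1 t.2.1}] (xb, pb, vh)) (𝓝 (g xb pb))

/-- (A2): parametric continuous prox-regularity. -/
def A2 (g : X → P → EReal) (xb : X) (pb : P) (vh : X) : Prop :=
  (∃ r > (0:ℝ), ProxRegWith g xb pb vh r) ∧ SubdiffCont g xb pb vh

/-- Threshold of prox-regularity. -/
def proxThreshold (g : X → P → EReal) (xb : X) (pb : P) (vh : X) : ℝ :=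
  sInf {r : ℝ | 0 < r ∧ ProxRegWith g xb pb vh r}

/-- (A3): basic constraint qualification. -/
def A3 (g : X → P → EReal) (xb : X) (pb : P) : Prop :=
  LipschitzLike (fun p => epi g p) pb (xb, (g xb pb).toReal)

/-- (A4): uniform partial differentiability with partial Jacobian continuous at the point. -/
def A4 (f : X → P → Q → X) (Df : X → P → Q → X →L[ℝ] X) (xb : X) (pb : P) (qb : Q) : Prop :=
  (∃ η > (0:ℝ), ∀ ε > (0:ℝ), ∃ δ > (0:ℝ), ∀ x p q,
      ‖x - xb‖ < η → dist p pb < η → dist q qb < η →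
      ∀ x', ‖x' - x‖ < δ →
        ‖f x' p q - f x p q - Df x p q (x' - x)‖ ≤ ε * ‖x' - x‖) ∧
  Tendsto (fun t : X × P × Q => Df t.1 t.2.1 t.2.2) (𝓝 (xb, pb, qb)) (𝓝 (Df xb pb qb))

/-- Solution map of the parametric variational system. -/
def SolMap (f : X → P → Q → X) (g : X → P → EReal) (v : X) (p : P) (q : Q) : Set X :=
  {x | v - f x p q ∈ pSubdiff g x p}

/-- Single-valued localization of a three-parametric solution map. -/
def Localizes3 (S : X → P → Q → Set X) (V : Set X) (Pn : Set P) (Qn : Set Q) (U : Set X)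
    (ϑ : X → P → Q → X) : Prop :=
  ∀ v ∈ V, ∀ p ∈ Pn, ∀ q ∈ Qn,
    ϑ v p q ∈ U ∧ ϑ v p q ∈ S v p q ∧ ∀ x ∈ U, x ∈ S v p q → x = ϑ v p q

/-- Lipschitzian full stability. -/
def LipFullStable (S : X → P → Q → Set X) (xb vb : X) (pb : P) (qb : Q) : Prop :=
  ∃ V ∈ 𝓝 vb, ∃ Pn ∈ 𝓝 pb, ∃ Qn ∈ 𝓝 qb, ∃ U ∈ 𝓝 xb, ∃ ϑ : X → P → Q → X,
    Localizes3 S V Pn Qn U ϑ ∧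
    ∃ κ > (0:ℝ), ∃ ℓ > (0:ℝ), ∀ v₁ ∈ V, ∀ p₁ ∈ Pn, ∀ q₁ ∈ Qn, ∀ v₂ ∈ V, ∀ p₂ ∈ Pn, ∀ q₂ ∈ Qn,
      ‖(v₁ - v₂) - (2 * κ) • (ϑ v₁ p₁ q₁ - ϑ v₂ p₂ q₂)‖
        ≤ ‖v₁ - v₂‖ + ℓ * (dist p₁ p₂ + dist q₁ q₂)

/-- Hölderian full stability with given moduli. -/
def HolderFullStableWith (S : X → P → Q → Set X) (xb vb : X) (pb : P) (qb : Q) (κ ℓ : ℝ) : Prop :=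
  ∃ V ∈ 𝓝 vb, ∃ Pn ∈ 𝓝 pb, ∃ Qn ∈ 𝓝 qb, ∃ U ∈ 𝓝 xb, ∃ ϑ : X → P → Q → X,
    Localizes3 S V Pn Qn U ϑ ∧
    ∀ v₁ ∈ V, ∀ p₁ ∈ Pn, ∀ q₁ ∈ Qn, ∀ v₂ ∈ V, ∀ p₂ ∈ Pn, ∀ q₂ ∈ Qn,
      ‖(v₁ - v₂) - (2 * κ) • (ϑ v₁ p₁ q₁ - ϑ v₂ p₂ q₂)‖
        ≤ ‖v₁ - v₂‖ + ℓ * (Real.sqrt (dist p₁ p₂) + dist q₁ q₂)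

/-- Hölderian full stability. -/
def HolderFullStable (S : X → P → Q → Set X) (xb vb : X) (pb : P) (qb : Q) : Prop :=
  ∃ κ > (0:ℝ), ∃ ℓ > (0:ℝ), HolderFullStableWith S xb vb pb qb κ ℓ

/-- Neighborhood second-order condition via the regular coderivative of ∂g_p. -/
def SOC (g : X → P → EReal) (A : X →L[ℝ] X) (xb : X) (pb : P) (vh : X) (η κ₀ : ℝ) : Prop :=
  ∀ u p v, ‖u - xb‖ ≤ η → dist p pb ≤ η → ‖v - vh‖ ≤ η → v ∈ pSubdiff g u p →
    ∀ w z, z ∈ regCoderiv (fun y => pSubdiff g y p) u v w →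
      κ₀ * ‖w‖ ^ 2 ≤ ⟪A w, w⟫ + ⟪z, w⟫

/-- The graphical map p ↦ gph ∂ₓ g(·,p). -/
def gphMap (g : X → P → EReal) (p : P) : Set (X × X) := {t | t.2 ∈ pSubdiff g t.1 p}

/-- Local strong monotonicity of f in x with modulus σ. -/
def StrongMono (f : X → P → Q → X) (xb : X) (pb : P) (qb : Q) (σ : ℝ) : Prop :=
  ∃ ε > (0:ℝ), ∀ x₁ x₂ p q, ‖x₁ - xb‖ < ε → ‖x₂ - xb‖ < ε → dist p pb < ε → dist q qb < ε →
    σ * ‖x₁ - x₂‖ ^ 2 ≤ ⟪f x₁ p q - f x₂ p q, x₁ - x₂⟫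

/-- The proximal mapping P_λ(v,p) = {x : v ∈ x + λ ∂ₓ g(x,p)}. -/
def proxMap (g : X → P → EReal) (lam : ℝ) (v : X) (p : P) : Set X :=
  {x | ∃ s ∈ pSubdiff g x p, v = x + lam • s}

/-- Single-valued localization of a two-parametric solution map. -/
def Localizes2 (S : X → P → Set X) (V : Set X) (Pn : Set P) (U : Set X) (ϑ : X → P → X) : Prop :=
  ∀ v ∈ V, ∀ p ∈ Pn, ϑ v p ∈ U ∧ ϑ v p ∈ S v p ∧ ∀ x ∈ U, x ∈ S v p → x = ϑ v p

/-- (Lipschitzian) full stability of a two-parametric system. -/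
def FullStable2 (S : X → P → Set X) (xb vb : X) (pb : P) : Prop :=
  ∃ V ∈ 𝓝 vb, ∃ Pn ∈ 𝓝 pb, ∃ U ∈ 𝓝 xb, ∃ ϑ : X → P → X,
    Localizes2 S V Pn U ϑ ∧
    ∃ κ > (0:ℝ), ∃ ℓ > (0:ℝ), ∀ v₁ ∈ V, ∀ p₁ ∈ Pn, ∀ v₂ ∈ V, ∀ p₂ ∈ Pn,
      ‖(v₁ - v₂) - (2 * κ) • (ϑ v₁ p₁ - ϑ v₂ p₂)‖ ≤ ‖v₁ - v₂‖ + ℓ * dist p₁ p₂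

/-- Normal cone of convex analysis. -/
def convNC (C : Set X) (x : X) : Set X := {v | x ∈ C ∧ ∀ y ∈ C, ⟪v, y - x⟫ ≤ 0}

/-- Solution map of a parametric variational inequality. -/
def SolMapVI (f : X → P → X) (C : Set X) (v : X) (p : P) : Set X :=
  {x | v - f x p ∈ convNC C x}

/-- Radial cone. -/
def radialCone (C : Set X) (x : X) : Set X := {w | ∃ t > (0:ℝ), x + t • w ∈ C}

/-- Tangent cone (closure of the radial cone). -/
def tangentC (C : Set X) (x : X) : Set X := closure (radialCone C x)

/-- Critical cone. -/
def criticalCone (C : Set X) (x v : X) : Set X := tangentC C x ∩ {w | ⟪v, w⟫ = 0}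

/-- Polyhedricity of a closed convex set. -/
def Polyhedric (C : Set X) : Prop :=
  ∀ x ∈ C, ∀ v ∈ convNC C x,
    criticalCone C x v = closure (radialCone C x ∩ {w | ⟪v, w⟫ = 0})

/-- Weak sequential outer limit of critical cones. -/
def Hw (C : Set X) (xb vh : X) : Set X :=
  {w | ∃ xs vs ws : ℕ → X, (∀ k, vs k ∈ convNC C (xs k)) ∧
      Tendsto xs atTop (𝓝 xb) ∧ Tendsto vs atTop (𝓝 vh) ∧
      (∀ k, ws k ∈ criticalCone C (xs k) (vs k)) ∧ WeakTendsto ws w}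

/-- Strong sequential outer limit of critical cones. -/
def Hs (C : Set X) (xb vh : X) : Set X :=
  {w | ∃ xs vs ws : ℕ → X, (∀ k, vs k ∈ convNC C (xs k)) ∧
      Tendsto xs atTop (𝓝 xb) ∧ Tendsto vs atTop (𝓝 vh) ∧
      (∀ k, ws k ∈ criticalCone C (xs k) (vs k)) ∧ Tendsto ws atTop (𝓝 w)}

/-- Convex polyhedron: finite intersection of closed half-spaces. -/
def IsPolyhedron (C : Set X) : Prop :=
  ∃ (k : ℕ) (a : Fin k → X) (b : Fin k → ℝ), C = {x | ∀ i, ⟪a i, x⟫ ≤ b i}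

/-- Legendre form. -/
def LegendreForm (Qf : X → ℝ) : Prop :=
  (∃ A : X →L[ℝ] X, ∀ x, Qf x = ⟪A x, x⟫) ∧
  (∀ (xs : ℕ → X) (x : X), WeakTendsto xs x → Qf x ≤ liminf (fun k => Qf (xs k)) atTop) ∧
  (∀ (xs : ℕ → X) (x : X), WeakTendsto xs x →
     Tendsto (fun k => Qf (xs k)) atTop (𝓝 (Qf x)) → Tendsto xs atTop (𝓝 x))

/-- (A1) for a two-parametric base mapping. -/
def A1two (f : X → P → X) (xb : X) (pb : P) : Prop :=
  ∃ L > (0:ℝ), ∃ ε > (0:ℝ), ∀ x₁ x₂ p₁ p₂,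
    ‖x₁ - xb‖ < ε → ‖x₂ - xb‖ < ε → dist p₁ pb < ε → dist p₂ pb < ε →
    ‖f x₁ p₁ - f x₂ p₂‖ ≤ L * (‖x₁ - x₂‖ + dist p₁ p₂)

/-- (A4) for a two-parametric base mapping. -/
def A4two (f : X → P → X) (Df : X → P → X →L[ℝ] X) (xb : X) (pb : P) : Prop :=
  (∃ η > (0:ℝ), ∀ ε > (0:ℝ), ∃ δ > (0:ℝ), ∀ x p,
      ‖x - xb‖ < η → dist p pb < η →
      ∀ x', ‖x' - x‖ < δ → ‖f x' p - f x p - Df x p (x' - x)‖ ≤ ε * ‖x' - x‖) ∧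
  Tendsto (fun t : X × P => Df t.1 t.2) (𝓝 (xb, pb)) (𝓝 (Df xb pb))

/-- Euclidean distance in X × ℝ. -/
def pairDist (a b : X × ℝ) : ℝ := Real.sqrt (‖a.1 - b.1‖ ^ 2 + |a.2 - b.2| ^ 2)

/-- Pompeiu–Hausdorff distance between subsets of X × ℝ (Euclidean product norm). -/
def hausPH (C₁ C₂ : Set (X × ℝ)) : ℝ :=
  sInf {η : ℝ | 0 ≤ η ∧ (∀ a ∈ C₁, ∃ b ∈ C₂, pairDist a b ≤ η) ∧
                 ∀ b ∈ C₂, ∃ a ∈ C₁, pairDist a b ≤ η}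

/-- Nonparametric prox-regularity with parameter r. -/
def ProxRegWithNP (g : X → EReal) (xb vh : X) (r : ℝ) : Prop :=
  ∃ ε > (0:ℝ), ∀ x u v, ‖x - xb‖ < ε → ‖u - xb‖ < ε → ‖v - vh‖ < ε →
    v ∈ limSubdiff g u → g u ≤ g xb + (ε : EReal) →
    g u + ((⟪v, x - u⟫ - r / 2 * ‖x - u‖ ^ 2 : ℝ) : EReal) ≤ g x

/-- Nonparametric subdifferential continuity. -/
def SubdiffContNP (g : X → EReal) (xb vh : X) : Prop :=
  Tendsto (fun t : X × X => g t.1) (𝓝[gph (limSubdiff g)] (xb, vh)) (𝓝 (g xb))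

/-- Nonparametric threshold of prox-regularity. -/
def proxThresholdNP (g : X → EReal) (xb vh : X) : ℝ :=
  sInf {r : ℝ | 0 < r ∧ ProxRegWithNP g xb vh r}



/-- Smooth variational principle of Borwein and Preiss in epigraphical form: an arbitrarily small
quadratic perturbation attains its minimum. -/
lemma exists_quadratic_perturbation_min [CompleteSpace X] {E : Set (X × ℝ)} (hE : IsClosed E)
    (hne : E.Nonempty) {m R δ : ℝ} (hm : ∀ e ∈ E, m ≤ e.2) (hR : ∀ e ∈ E, ‖e.1‖ ≤ R)
    (hδ : 0 < δ) :
    ∃ d : X, ‖d‖ ≤ δ * R ∧ ∃ e ∈ E, ∀ e' ∈ E,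
      e.2 + δ * ‖e.1‖ ^ 2 - 2 * ⟪d, e.1⟫ ≤ e'.2 + δ * ‖e'.1‖ ^ 2 - 2 * ⟪d, e'.1⟫ := by
  have bddBelow : ∀ (A : ℝ) (d : X), 0 ≤ A → ∀ e ∈ E,
      m - 2 * (‖d‖ * R) ≤ e.2 + A * ‖e.1‖ ^ 2 - 2 * ⟪d, e.1⟫ := by
    intro A d hA e he
    have h1 := hm e he
    have h2 : ⟪d, e.1⟫ ≤ ‖d‖ * R :=
      (real_inner_le_norm _ _).trans (mul_le_mul_of_nonneg_left (hR e he) (norm_nonneg _))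
    have h3 : 0 ≤ A * ‖e.1‖ ^ 2 := by positivity
    linarith
  have nearMin : ∀ (n : ℕ) (d : X), ∃ e ∈ E, ∀ e' ∈ E,
      e.2 + δ * (1 - (1 / 2) ^ n) * ‖e.1‖ ^ 2 - 2 * ⟪d, e.1⟫
        ≤ e'.2 + δ * (1 - (1 / 2) ^ n) * ‖e'.1‖ ^ 2 - 2 * ⟪d, e'.1⟫ + (1 / 8) ^ n := by
    intro n d
    have hA : 0 ≤ δ * (1 - (1 / 2 : ℝ) ^ n) :=
      mul_nonneg hδ.le (sub_nonneg.2 (pow_le_one₀ (by norm_num) (by norm_num)))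
    set φ : X × ℝ → ℝ :=
      fun e => e.2 + δ * (1 - (1 / 2) ^ n) * ‖e.1‖ ^ 2 - 2 * ⟪d, e.1⟫ with hφ
    have hb : BddBelow (φ '' E) :=
      ⟨m - 2 * (‖d‖ * R), by rintro _ ⟨e, he, rfl⟩; exact bddBelow _ d hA e he⟩
    obtain ⟨_, ⟨e, he, rfl⟩, hlt⟩ := exists_lt_of_csInf_lt (hne.image φ)
      (lt_add_of_pos_right (sInf (φ '' E)) (by positivity : (0 : ℝ) < (1 / 8) ^ n))
    refine ⟨e, he, fun e' he' => ?_⟩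
    have := csInf_le hb (mem_image_of_mem φ he')
    simp only [hφ] at hlt this ⊢
    linarith
  choose pick pickE pickMin using nearMin
  let d : ℕ → X := fun n => Nat.rec 0 (fun n d => d + (δ / 2 * (1 / 2) ^ n) • (pick n d).1) n
  have d_succ : ∀ n, d (n + 1) = d n + (δ / 2 * (1 / 2) ^ n) • (pick n (d n)).1 := fun n => rfl
  set e : ℕ → X × ℝ := fun n => pick n (d n) with he
  have heE : ∀ n, e n ∈ E := fun n => pickE n (d n)
  have hR0 : 0 ≤ R := (norm_nonneg _).trans (hR _ (heE 0))
  have d_step : ∀ n, dist (d n) (d (n + 1)) ≤ (δ / 2 * R) * (1 / 2) ^ n := by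
    intro n
    rw [d_succ, dist_self_add_right, norm_smul, Real.norm_of_nonneg (by positivity)]
    have := hR _ (heE n)
    calc δ / 2 * (1 / 2) ^ n * ‖(pick n (d n)).1‖ ≤ δ / 2 * (1 / 2) ^ n * R := by gcongr
      _ = _ := by ring
  obtain ⟨D, hD⟩ := cauchySeq_tendsto_of_complete
    (cauchySeq_of_le_geometric _ _ (by norm_num : (1 / 2 : ℝ) < 1) d_step)
  have hDnorm : ‖D‖ ≤ δ * R := by
    have := dist_le_of_le_geometric_of_tendsto₀ _ _ (by norm_num : (1 / 2 : ℝ) < 1) d_step hD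
    have h0 : d 0 = 0 := rfl
    rw [h0, dist_zero_left] at this
    exact this.trans_eq (by ring)
  have x_step : ∀ n, dist (e n).1 (e (n + 1)).1 ≤ (2 / √δ) * (1 / 2) ^ n := by
    intro n
    have h1 := pickMin n (d n) (e (n + 1)) (heE _)
    have h2 := pickMin (n + 1) (d (n + 1)) (e n) (heE _)
    change (e n).2 + _ * ‖(e n).1‖ ^ 2 - 2 * ⟪d n, (e n).1⟫ ≤ _ at h1
    change (e (n + 1)).2 + _ * ‖(e (n + 1)).1‖ ^ 2 - 2 * ⟪d (n + 1), (e (n + 1)).1⟫ ≤ _ at h2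
    have h3 : d (n + 1) = d n + (δ / 2 * (1 / 2) ^ n) • (e n).1 := d_succ n
    rw [h3] at h2
    simp only [inner_add_left, real_inner_smul_left, real_inner_self_eq_norm_sq, pow_succ] at h2
    have h4 : δ / 2 * (1 / 2) ^ n * ‖(e n).1 - (e (n + 1)).1‖ ^ 2 ≤ 2 * (1 / 8) ^ n := by
      rw [norm_sub_sq_real]
      have : (0 : ℝ) < (1 / 8) ^ n := by positivity
      nlinarith
    have h8 : (1 / 8 : ℝ) ^ n = (1 / 2) ^ n * ((1 / 2) ^ n * (1 / 2) ^ n) := by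
      rw [← mul_pow, ← mul_pow]; norm_num
    have h5 : ‖(e n).1 - (e (n + 1)).1‖ ^ 2 ≤ ((2 / √δ) * (1 / 2) ^ n) ^ 2 := by
      rw [mul_pow, div_pow, Real.sq_sqrt hδ.le]
      have hp : (0 : ℝ) < (1 / 2) ^ n := by positivity
      rw [h8] at h4
      have h6 : δ * ‖(e n).1 - (e (n + 1)).1‖ ^ 2 ≤ 4 * ((1 / 2) ^ n) ^ 2 := by
        refine le_of_mul_le_mul_left ?_ hp
        nlinarith
      rw [div_mul_eq_mul_div, le_div_iff₀ hδ]
      linarith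
    rw [dist_eq_norm]
    exact le_of_sq_le_sq h5 (by positivity)
  obtain ⟨xh, hxh⟩ := cauchySeq_tendsto_of_complete
    (cauchySeq_of_le_geometric _ _ (by norm_num : (1 / 2 : ℝ) < 1) x_step)
  set Φ : X × ℝ → ℝ := fun e => e.2 + δ * ‖e.1‖ ^ 2 - 2 * ⟪D, e.1⟫ with hΦ
  have hb : BddBelow (Φ '' E) :=
    ⟨m - 2 * (‖D‖ * R), by rintro _ ⟨e, he, rfl⟩; exact bddBelow _ D hδ.le e he⟩
  have hupper : ∀ n, ∀ e' ∈ E,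
      Φ (e n) - ((1 / 8) ^ n + 2 * (δ * (1 / 2) ^ n * R ^ 2 + 2 * (‖d n - D‖ * R))) ≤ Φ e' := by
    intro n e' he'
    have h1 := pickMin n (d n) e' he'
    change (e n).2 + _ * ‖(e n).1‖ ^ 2 - 2 * ⟪d n, (e n).1⟫ ≤ _ at h1
    have h2 : ∀ c ∈ E, |⟪d n, c.1⟫ - ⟪D, c.1⟫| ≤ ‖d n - D‖ * R := by
      intro c hc
      rw [← inner_sub_left]
      exact (abs_real_inner_le_norm _ _).trans
        (mul_le_mul_of_nonneg_left (hR c hc) (norm_nonneg _))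
    have h3 : ∀ c ∈ E, δ * (1 / 2) ^ n * ‖c.1‖ ^ 2 ≤ δ * (1 / 2) ^ n * R ^ 2 := by
      intro c hc
      have := hR c hc
      gcongr
    have h4 := abs_le.1 (h2 _ (heE n))
    have h5 := abs_le.1 (h2 _ he')
    have h6 := h3 _ (heE n)
    have h7 : 0 ≤ δ * (1 / 2) ^ n * ‖e'.1‖ ^ 2 := by positivity
    have h8 : 0 ≤ δ * (1 / 2) ^ n * R ^ 2 := by positivity
    simp only [hΦ]
    nlinarith [h4.1, h4.2, h5.1, h5.2]
  have hτ : Tendsto (fun n => (1 / 8 : ℝ) ^ n +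
      2 * (δ * (1 / 2) ^ n * R ^ 2 + 2 * (‖d n - D‖ * R))) atTop (𝓝 0) := by
    have t1 := tendsto_pow_atTop_nhds_zero_of_lt_one (r := (1 / 8 : ℝ)) (by norm_num) (by norm_num)
    have t2 := tendsto_pow_atTop_nhds_zero_of_lt_one (r := (1 / 2 : ℝ)) (by norm_num) (by norm_num)
    have t3 := (tendsto_iff_norm_sub_tendsto_zero.1 hD).mul_const R
    simpa using t1.add ((((t2.const_mul δ).mul_const (R ^ 2)).add (t3.const_mul 2)).const_mul 2)
  have hΦlim : Tendsto (fun n => Φ (e n)) atTop (𝓝 (sInf (Φ '' E))) := by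
    refine tendsto_of_tendsto_of_tendsto_of_le_of_le tendsto_const_nhds
      (by simpa only [add_zero] using hτ.const_add (sInf (Φ '' E)))
      (fun n => csInf_le hb (mem_image_of_mem Φ (heE n))) (fun n => ?_)
    have : Φ (e n) - ((1 / 8) ^ n + 2 * (δ * (1 / 2) ^ n * R ^ 2 + 2 * (‖d n - D‖ * R)))
        ≤ sInf (Φ '' E) := by
      refine le_csInf (hne.image Φ) ?_
      rintro _ ⟨e', he', rfl⟩
      exact hupper n e' he'
    linarith
  have halim : Tendsto (fun n => (e n).2) atTop
      (𝓝 (sInf (Φ '' E) - δ * ‖xh‖ ^ 2 + 2 * ⟪D, xh⟫)) := by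
    have := (hΦlim.sub ((hxh.norm.pow 2).const_mul δ)).add
      (((tendsto_const_nhds (x := D)).inner hxh).const_mul 2)
    refine this.congr fun n => ?_
    simp only [hΦ]
    ring
  refine ⟨D, hDnorm, (xh, sInf (Φ '' E) - δ * ‖xh‖ ^ 2 + 2 * ⟪D, xh⟫),
    hE.mem_of_tendsto (hxh.prodMk_nhds halim) (Eventually.of_forall heE), fun e' he' => ?_⟩
  have := csInf_le hb (mem_image_of_mem Φ he')
  simp only [hΦ] at this ⊢
  linarith

lemma mem_regSubdiff_of_quadratic_minorant {h : X → EReal} {x v : X} {α K : ℝ}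
    (hbot : ∀ u, h u ≠ ⊥) (hα : h x = α)
    (hq : ∀ᶠ u in 𝓝 x, ∀ a : ℝ, h u ≤ a → α + ⟪v, u - x⟫ - K * ‖u - x‖ ^ 2 ≤ a) :
    v ∈ regSubdiff h x := by
  refine ⟨by simp [hα], by simp [hα], fun ε hε => ?_⟩
  filter_upwards [hq, Metric.ball_mem_nhds x (by positivity : 0 < ε / (|K| + 1))] with u hu hball
  rw [mem_ball, dist_eq_norm, lt_div_iff₀ (by positivity)] at hball
  by_cases htop : h u = ⊤
  · simp [htop]
  · lift h u to ℝ using ⟨htop, hbot u⟩ with a ha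
    have h1 := hu a le_rfl
    have h2 : K * ‖u - x‖ ^ 2 ≤ ε * ‖u - x‖ := by
      have := le_abs_self K
      have h0 := norm_nonneg (u - x)
      nlinarith [mul_nonneg h0 h0, mul_le_mul_of_nonneg_left hball.le h0,
        mul_le_mul_of_nonneg_right this (mul_nonneg h0 h0)]
    rw [hα]
    norm_cast
    linarith

lemma regSubdiff_subset_limSubdiff (h : X → EReal) (x : X) : regSubdiff h x ⊆ limSubdiff h x :=
  fun v hv => ⟨fun _ => x, fun _ => v, tendsto_const_nhds, tendsto_const_nhds, fun _ => hv,
    fun _ => tendsto_const_nhds⟩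

lemma ProxRegWith.mono {g : X → P → EReal} {xb vh : X} {pb : P} {r r' : ℝ}
    (h : ProxRegWith g xb pb vh r) (hr : r ≤ r') : ProxRegWith g xb pb vh r' := by
  obtain ⟨ε, hε, H⟩ := h
  refine ⟨ε, hε, fun x u p v hx hu hp hv hvs => le_trans ?_ (H x u p v hx hu hp hv hvs)⟩
  gcongr

lemma proxRegWith_of_proxThreshold_lt {g : X → P → EReal} {xb vh : X} {pb : P} {r : ℝ}
    (hA2 : A2 g xb pb vh) (hr : proxThreshold g xb pb vh < r) :
    0 < r ∧ ProxRegWith g xb pb vh r := by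
  obtain ⟨r₀, hr₀, hr₀'⟩ := hA2.1
  obtain ⟨r₁, ⟨hr₁, hr₁'⟩, hlt⟩ := exists_lt_of_csInf_lt
    (s := {r : ℝ | 0 < r ∧ ProxRegWith g xb pb vh r}) ⟨r₀, hr₀, hr₀'⟩ hr
  exact ⟨hr₁.trans hlt, hr₁'.mono hlt.le⟩

/-- Near the reference point, subgradients are taken at points where the function is finite, and
the prox-regularity inequality holds on the epigraph. -/
lemma ProxRegWith.exists_finite_epi {g : X → P → EReal} {xb vh : X} {pb : P} {r : ℝ}
    (h : ProxRegWith g xb pb vh r) (hg_proper : ∀ x p, g x p ≠ ⊥) :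
    ∃ ε > (0 : ℝ), ∀ u p v, ‖u - xb‖ < ε → dist p pb < ε → ‖v - vh‖ < ε → v ∈ pSubdiff g u p →
      ∃ α : ℝ, g u p = α ∧ ∀ x (a : ℝ), ‖x - xb‖ < ε → g x p ≤ a →
        α + ⟪v, x - u⟫ - r / 2 * ‖x - u‖ ^ 2 ≤ a := by
  obtain ⟨ε, hε, H⟩ := h
  refine ⟨ε, hε, fun u p v hu hp hv hvs => ?_⟩
  have hfin : g u p ≠ ⊤ := by
    intro htop
    have hvs' := hvs
    obtain ⟨xs, vs, hxs, -, hreg, -⟩ := hvs'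
    have hev : ∀ᶠ k in atTop, ‖xs k - xb‖ < ε :=
      (hxs.sub_const xb).norm.eventually_lt_const hu
    obtain ⟨k, hk⟩ := hev.exists
    have := H (xs k) u p v hk hu hp hv hvs
    rw [htop, EReal.top_add_coe, top_le_iff] at this
    exact (hreg k).1 this
  lift g u p to ℝ using ⟨hfin, hg_proper u p⟩ with α hα
  refine ⟨α, rfl, fun x a hx ha => ?_⟩
  have := (H x u p v hx hu hp hv hvs).trans ha
  rw [← hα] at this
  norm_cast at this
  linarith

/-- Prox-regularity inequality linking different values of the parameter. -/
lemma exists_parametric_prox_inequality {g : X → P → EReal} {xb vh : X} {pb : P} {r : ℝ}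
    (hg_proper : ∀ x p, g x p ≠ ⊥) (hr : 0 ≤ r) (h : ProxRegWith g xb pb vh r)
    (hA3 : A3 g xb pb) :
    ∃ ρ > (0 : ℝ), ∃ C ≥ (0 : ℝ), ∀ u p' s, ‖u - xb‖ < ρ → dist p' pb < ρ → ‖s - vh‖ < ρ →
      s ∈ pSubdiff g u p' → ∀ α : ℝ, g u p' = α → ∀ x p (a : ℝ), ‖x - xb‖ < ρ → dist p pb < ρ →
        |a - (g xb pb).toReal| < ρ → g x p ≤ a →
          α + ⟪s, x - u⟫ - r / 2 * ‖x - u‖ ^ 2 - C * dist p p' ≤ a := by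
  obtain ⟨ε, hε, H⟩ := h.exists_finite_epi hg_proper
  obtain ⟨ℓ, hℓ, U, hU, V, hV, hLip⟩ := hA3
  obtain ⟨ε₁, hε₁, hU⟩ := Metric.mem_nhds_iff.1 hU
  obtain ⟨ε₂, hε₂, hV⟩ := Metric.mem_nhds_iff.1 hV
  obtain ⟨ρ, hρ, hlt⟩ : ∃ ρ > (0 : ℝ), ρ < min (min (min (ε / 2) ε₁) (min ε₂ (1 / 2)))
      (min (ε / (4 * ℓ)) (1 / (2 * ℓ))) := exists_between (by positivity)
  simp only [lt_min_iff] at hlt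
  obtain ⟨⟨⟨hρε, hρ₁⟩, hρ₂, hρh⟩, hρ3, hρ4⟩ := hlt
  rw [lt_div_iff₀ (by positivity)] at hρ3 hρ4
  refine ⟨ρ, hρ, ℓ * (1 + (‖vh‖ + 1) + 3 * r / 2), by positivity, ?_⟩
  intro u p' s hu hp' hs hsub α hα x p a hx hp ha hga
  obtain ⟨α', hα', H⟩ := H u p' s (by linarith) (by linarith) (by linarith) hsub
  obtain rfl : α = α' := by rw [hα] at hα'; exact_mod_cast hα'
  have hmem : ((x, a) : X × ℝ) ∈ epi g p ∩ V := by
    refine ⟨hga, hV ?_⟩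
    rw [mem_ball, Prod.dist_eq, max_lt_iff, dist_eq_norm, Real.dist_eq]
    exact ⟨hx.trans hρ₂, ha.trans hρ₂⟩
  obtain ⟨⟨x', a'⟩, hx'a', hdist⟩ := hLip p (hU (hp.trans hρ₁)) p' (hU (hp'.trans hρ₁)) _ hmem
  rw [Prod.norm_def, max_le_iff] at hdist
  obtain ⟨hdx, hda⟩ := hdist
  simp only [Prod.fst_sub, Prod.snd_sub] at hdx hda
  have hd : dist p p' < 2 * ρ := by
    have := dist_triangle_right p p' pb
    linarith
  set D := ℓ * dist p p' with hD
  have hD0 : 0 ≤ D := by positivity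
  have hDlt : D < 2 * (ℓ * ρ) := by
    rw [hD]; nlinarith
  have hx'b : ‖x' - xb‖ < ε := by
    have := norm_sub_le_norm_sub_add_norm_sub x' x xb
    rw [norm_sub_rev x' x] at this
    nlinarith
  have key := H x' a' hx'b hx'a'
  have e1 : a' ≤ a + D := by
    have := (abs_le.1 (Real.norm_eq_abs (a - a') ▸ hda)).1
    linarith
  have e2 : ⟪s, x - u⟫ - (‖vh‖ + 1) * D ≤ ⟪s, x' - u⟫ := by
    have h1 : ⟪s, x - u⟫ - ⟪s, x' - u⟫ = ⟪s, x - x'⟫ := by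
      rw [← inner_sub_right]; congr 1; abel
    have h2 := real_inner_le_norm s (x - x')
    have h3 : ‖s‖ ≤ ‖vh‖ + 1 := by
      have := norm_le_norm_add_norm_sub' s vh
      linarith
    have h4 : ‖s‖ * ‖x - x'‖ ≤ (‖vh‖ + 1) * D := by gcongr
    linarith
  have e3 : ‖x' - u‖ ^ 2 ≤ ‖x - u‖ ^ 2 + 3 * D := by
    have h1 : ‖x' - u‖ ≤ ‖x - u‖ + D := by
      have := norm_sub_le_norm_sub_add_norm_sub x' x u
      rw [norm_sub_rev x' x] at this
      linarith
    have h2 : ‖x - u‖ ≤ 1 := by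
      have := norm_sub_le_norm_sub_add_norm_sub x xb u
      rw [norm_sub_rev xb u] at this
      linarith
    have h3 : D ≤ 1 := by linarith
    have h4 := norm_nonneg (x - u)
    have h5 := norm_nonneg (x' - u)
    nlinarith
  have e4 : r / 2 * ‖x' - u‖ ^ 2 ≤ r / 2 * (‖x - u‖ ^ 2 + 3 * D) := by gcongr
  have e5 : ℓ * (1 + (‖vh‖ + 1) + 3 * r / 2) * dist p p' = D * (1 + (‖vh‖ + 1) + 3 * r / 2) := by
    rw [hD]; ring
  rw [e5]
  linarith

/-- Local hypomonotonicity of the partial subdifferential with an error that is linear in the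
change of parameter. -/
lemma exists_parametric_hypomonotone {g : X → P → EReal} {xb vh : X} {pb : P} {r : ℝ}
    (hg_proper : ∀ x p, g x p ≠ ⊥) (hr : 0 ≤ r) (h : ProxRegWith g xb pb vh r)
    (hcont : SubdiffCont g xb pb vh) (hA3 : A3 g xb pb) (hsub : vh ∈ pSubdiff g xb pb) :
    ∃ ρ > (0 : ℝ), ∃ C ≥ (0 : ℝ), ∀ x₁ p₁ s₁ x₂ p₂ s₂,
      ‖x₁ - xb‖ < ρ → dist p₁ pb < ρ → ‖s₁ - vh‖ < ρ → s₁ ∈ pSubdiff g x₁ p₁ →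
      ‖x₂ - xb‖ < ρ → dist p₂ pb < ρ → ‖s₂ - vh‖ < ρ → s₂ ∈ pSubdiff g x₂ p₂ →
        -r * ‖x₁ - x₂‖ ^ 2 - C * dist p₁ p₂ ≤ ⟪s₁ - s₂, x₁ - x₂⟫ := by
  obtain ⟨ρ, hρ, C, hC, K⟩ := exists_parametric_prox_inequality hg_proper hr h hA3
  obtain ⟨ε, hε, H⟩ := h.exists_finite_epi hg_proper
  obtain ⟨γ, hγ, -⟩ := H xb pb vh (by simpa) (by simpa) (by simpa) hsub
  have hval : ∃ ε' > (0 : ℝ), ∀ x p s, ‖x - xb‖ < ε' → dist p pb < ε' → ‖s - vh‖ < ε' →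
      s ∈ pSubdiff g x p → ∀ α : ℝ, g x p = α → |α - (g xb pb).toReal| < ρ := by
    have hI : Ioo ((γ - ρ : ℝ) : EReal) ((γ + ρ : ℝ) : EReal) ∈ 𝓝 (g xb pb) := by
      rw [hγ]
      exact Ioo_mem_nhds (by norm_cast; linarith) (by norm_cast; linarith)
    obtain ⟨ε', hε', hsubset⟩ := Metric.mem_nhdsWithin_iff.1 (hcont hI)
    refine ⟨ε', hε', fun x p s hx hp hs hmem α hα => ?_⟩
    have := hsubset ⟨(by simpa [Prod.dist_eq, dist_eq_norm] using ⟨hx, hp, hs⟩ :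
      ((x, p, s) : X × P × X) ∈ ball (xb, pb, vh) ε'), hmem⟩
    simp only [mem_preimage, hα, mem_Ioo, EReal.coe_lt_coe_iff] at this
    rw [hγ, EReal.toReal_coe, abs_lt]
    constructor <;> linarith [this.1, this.2]
  obtain ⟨ε', hε', hval⟩ := hval
  refine ⟨min ρ (min ε ε'), by positivity, 2 * C, by positivity, ?_⟩
  intro x₁ p₁ s₁ x₂ p₂ s₂ hx₁ hp₁ hs₁ hm₁ hx₂ hp₂ hs₂ hm₂
  simp only [lt_min_iff] at hx₁ hp₁ hs₁ hx₂ hp₂ hs₂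
  obtain ⟨α₁, hα₁, -⟩ := H x₁ p₁ s₁ hx₁.2.1 hp₁.2.1 hs₁.2.1 hm₁
  obtain ⟨α₂, hα₂, -⟩ := H x₂ p₂ s₂ hx₂.2.1 hp₂.2.1 hs₂.2.1 hm₂
  have k₁ := K x₁ p₁ s₁ hx₁.1 hp₁.1 hs₁.1 hm₁ α₁ hα₁ x₂ p₂ α₂ hx₂.1 hp₂.1
    (hval x₂ p₂ s₂ hx₂.2.2 hp₂.2.2 hs₂.2.2 hm₂ α₂ hα₂) hα₂.le
  have k₂ := K x₂ p₂ s₂ hx₂.1 hp₂.1 hs₂.1 hm₂ α₂ hα₂ x₁ p₁ α₁ hx₁.1 hp₁.1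
    (hval x₁ p₁ s₁ hx₁.2.2 hp₁.2.2 hs₁.2.2 hm₁ α₁ hα₁) hα₁.le
  have e : ⟪s₁ - s₂, x₁ - x₂⟫ = -⟪s₁, x₂ - x₁⟫ - ⟪s₂, x₁ - x₂⟫ := by
    rw [inner_sub_left, ← inner_neg_right, neg_sub]
  rw [dist_comm p₂ p₁, norm_sub_rev x₂ x₁] at k₁
  rw [e]
  linarith

/-- Quadratic lower growth, uniform in the parameter, of a prox-regular function. -/
lemma exists_parametric_lower_growth {g : X → P → EReal} {xb vh : X} {pb : P} {r γ : ℝ}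
    (hg_lsc : LowerSemicontinuous fun t : X × P => g t.1 t.2)
    (hg_proper : ∀ x p, g x p ≠ ⊥) (hr : 0 ≤ r) (h : ProxRegWith g xb pb vh r)
    (hA3 : A3 g xb pb) (hsub : vh ∈ pSubdiff g xb pb) (hγ : g xb pb = γ) :
    ∃ ρ > (0 : ℝ), ∃ C ≥ (0 : ℝ), ∀ x p (a : ℝ), ‖x - xb‖ < ρ → dist p pb < ρ → g x p ≤ a →
      γ + ⟪vh, x - xb⟫ - r / 2 * ‖x - xb‖ ^ 2 - C * dist p pb ≤ a := by
  obtain ⟨ρ, hρ, C, hC, K⟩ := exists_parametric_prox_inequality hg_proper hr h hA3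
  have hlt : ((γ - ρ : ℝ) : EReal) < g xb pb := by rw [hγ]; norm_cast; linarith
  obtain ⟨ε, hε, hlow⟩ := Metric.eventually_nhds_iff.1 (hg_lsc (xb, pb) _ hlt)
  refine ⟨min (min ρ ε) (ρ / (‖vh‖ + 1)), by positivity, C, hC, fun x p a hx hp ha => ?_⟩
  simp only [lt_min_iff] at hx hp
  obtain ⟨⟨hx₁, hx₂⟩, hx₃⟩ := hx
  rw [lt_div_iff₀ (by positivity)] at hx₃
  have hlow' : γ - ρ < a := by
    have := (hlow (y := (x, p)) (by simpa [Prod.dist_eq, dist_eq_norm] using ⟨hx₂, hp.1.2⟩)).trans_le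
      ha
    exact_mod_cast this
  rcases lt_or_ge a (γ + ρ) with hlt | hge
  · refine K xb pb vh (by simpa) (by simpa) (by simpa) hsub γ hγ x p a hx₁ hp.1.1 ?_ ha
    rw [hγ, EReal.toReal_coe, abs_lt]
    constructor <;> linarith
  · have h1 := real_inner_le_norm vh (x - xb)
    have h2 := norm_nonneg (x - xb)
    have h3 : 0 ≤ r / 2 * ‖x - xb‖ ^ 2 := by positivity
    have h4 : 0 ≤ C * dist p pb := by positivity
    linarith

lemma A3.exists_approx_value {Z : Type*} [NormedAddCommGroup Z] {g : Z → P → EReal} {xb : Z}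
    {pb : P} {γ : ℝ} (hA3 : A3 g xb pb) (hγ : g xb pb = γ) :
    ∃ ρ > (0 : ℝ), ∃ ℓ > (0 : ℝ), ∀ p, dist p pb < ρ → ∃ x, ‖x - xb‖ ≤ ℓ * dist p pb ∧
      g x p ≤ ((γ + ℓ * dist p pb : ℝ) : EReal) := by
  obtain ⟨ℓ, hℓ, U, hU, V, hV, hLip⟩ := hA3
  obtain ⟨ρ, hρ, hU'⟩ := Metric.mem_nhds_iff.1 hU
  refine ⟨ρ, hρ, ℓ, hℓ, fun p hp => ?_⟩
  obtain ⟨⟨x, a⟩, hxa, hd⟩ := hLip pb (mem_of_mem_nhds hU) p (hU' hp) (xb, γ)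
    ⟨hγ.le, by have := mem_of_mem_nhds hV; rwa [hγ, EReal.toReal_coe] at this⟩
  rw [Prod.norm_def, max_le_iff] at hd
  simp only [Prod.fst_sub, Prod.snd_sub] at hd
  refine ⟨x, by rw [norm_sub_rev, dist_comm]; exact hd.1, hxa.trans ?_⟩
  have := (abs_le.1 (Real.norm_eq_abs (γ - a) ▸ hd.2)).1
  rw [dist_comm] at this
  norm_cast
  linarith

/-- The proximal inclusion is solvable up to an arbitrarily small error. -/
lemma exists_approx_prox [CompleteSpace X] {g : X → P → EReal} {xb vh : X} {pb : P} {r μ : ℝ}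
    (hg_lsc : LowerSemicontinuous fun t : X × P => g t.1 t.2)
    (hg_proper : ∀ x p, g x p ≠ ⊥) (hr : 0 ≤ r) (h : ProxRegWith g xb pb vh r)
    (hA3 : A3 g xb pb) (hsub : vh ∈ pSubdiff g xb pb) (hμ : r < μ) {ρ : ℝ} (hρ : 0 < ρ) :
    ∃ η > (0 : ℝ), ∀ p v, dist p pb < η → ‖v - vh‖ < η → ∀ e > (0 : ℝ), ∃ x w,
      ‖x - xb‖ < ρ ∧ ‖w‖ ≤ e ∧ v + w - μ • (x - xb) ∈ regSubdiff (fun y => g y p) x := by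
  obtain ⟨ε, hε, H⟩ := h.exists_finite_epi hg_proper
  obtain ⟨γ, hγ, -⟩ := H xb pb vh (by simpa) (by simpa) (by simpa) hsub
  obtain ⟨ρL, hρL, C, hC, hlow⟩ :=
    exists_parametric_lower_growth hg_lsc hg_proper hr h hA3 hsub hγ
  obtain ⟨ρU, hρU, ℓ, hℓ, hup⟩ := hA3.exists_approx_value hγ
  have hμ0 : 0 < μ := hr.trans_lt hμ
  obtain ⟨ρ₁, hρ₁, hρ₁lt⟩ : ∃ ρ₁ > (0 : ℝ), ρ₁ < min ρ ρL := exists_between (by positivity)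
  rw [lt_min_iff] at hρ₁lt
  set M := ρ₁ + C + ℓ + (‖vh‖ + 1) * ℓ + μ / 2 * ℓ with hM
  have hMpos : 0 < M := by positivity
  set T := (μ - r) * ρ₁ ^ 2 with hT
  have hTpos : 0 < T := mul_pos (by linarith) (by positivity)
  obtain ⟨η, hη, hηlt⟩ : ∃ η > (0 : ℝ), η < min (min (min ρL ρU) (min 1 (ρ₁ / ℓ)))
      (min (1 / ℓ) (T / (8 * M))) := exists_between (by positivity)
  simp only [lt_min_iff] at hηlt
  obtain ⟨⟨⟨hηL, hηU⟩, hη1, hηρ⟩, hηℓ, hηM⟩ := hηlt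
  rw [lt_div_iff₀ (by positivity)] at hηρ hηℓ hηM
  refine ⟨η, hη, fun p v hp hv e he => ?_⟩
  set R := ‖xb‖ + ρ₁ with hR
  have hRpos : 0 < R := by positivity
  obtain ⟨δ, hδ, hδlt⟩ : ∃ δ > (0 : ℝ), δ < min (e / (4 * R)) (T / (40 * R ^ 2)) :=
    exists_between (by positivity)
  simp only [lt_min_iff] at hδlt
  obtain ⟨hδe, hδT⟩ := hδlt
  rw [lt_div_iff₀ (by positivity)] at hδe hδT
  set k : X → ℝ := fun x => -⟪v, x - xb⟫ + μ / 2 * ‖x - xb‖ ^ 2 with hk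
  have hkcont : Continuous k := by fun_prop
  set E : Set (X × ℝ) :=
    {t | t.1 ∈ closedBall xb ρ₁ ∧ g t.1 p ≤ ((t.2 - k t.1 : ℝ) : EReal)} with hE
  have hEclosed : IsClosed E := by
    refine (isClosed_closedBall.preimage continuous_fst).inter ?_
    have hepi := (hg_lsc.comp (Continuous.prodMk_left p)).isClosed_epigraph
    exact hepi.preimage (f := fun t : X × ℝ => (t.1, ((t.2 - k t.1 : ℝ) : EReal)))
      (continuous_fst.prodMk (continuous_coe_real_ereal.comp
        (continuous_snd.sub (hkcont.comp continuous_fst))))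
  set D := dist p pb with hD
  have hD0 : 0 ≤ D := dist_nonneg
  obtain ⟨xp, hxp, hgxp⟩ := hup p (hp.trans hηU)
  have hℓη : ℓ * D ≤ η * ℓ := by rw [mul_comm η]; gcongr
  have hℓD1 : ℓ * D ≤ 1 := hℓη.trans hηℓ.le
  have hℓDρ : ℓ * D ≤ ρ₁ := hℓη.trans hηρ.le
  have hxpE : (xp, γ + ℓ * D + k xp) ∈ E := by
    refine ⟨by simpa [mem_closedBall, dist_eq_norm] using hxp.trans hℓDρ, ?_⟩
    simpa using hgxp
  have hnorm : ∀ x ∈ closedBall xb ρ₁, ‖x‖ ≤ R := by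
    intro x hx
    rw [mem_closedBall, dist_eq_norm] at hx
    have := norm_le_norm_add_norm_sub' x xb
    linarith
  have hlowE : ∀ t ∈ E, γ - ‖v - vh‖ * ρ₁ + (μ - r) / 2 * ‖t.1 - xb‖ ^ 2 - C * D ≤ t.2 := by
    rintro ⟨x, a⟩ ⟨hx, ha⟩
    rw [mem_closedBall, dist_eq_norm] at hx
    simp only at hx ha ⊢
    have h1 := hlow x p _ (by linarith) (hp.trans hηL) ha
    have h2 : ⟪v, x - xb⟫ - ⟪vh, x - xb⟫ ≤ ‖v - vh‖ * ρ₁ := by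
      rw [← inner_sub_left]
      exact (real_inner_le_norm _ _).trans (by gcongr)
    simp only [hk] at h1
    linarith
  obtain ⟨d, hd, ⟨xh, b⟩, ⟨hxh, hb⟩, hmin⟩ := exists_quadratic_perturbation_min hEclosed ⟨_, hxpE⟩
    (m := γ - ‖v - vh‖ * ρ₁ - C * D)
    (fun t ht => by
      have h1 := hlowE t ht
      have h2 : 0 ≤ (μ - r) / 2 * ‖t.1 - xb‖ ^ 2 := mul_nonneg (by linarith) (by positivity)
      linarith)
    (fun t ht => hnorm _ ht.1) hδ
  simp only at hxh hb hmin
  have hxhR := hnorm _ hxh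
  have hdR : ‖d‖ * R ≤ δ * R * R := by gcongr
  have hinterior : ‖xh - xb‖ < ρ₁ := by
    have h1 := hlowE (xh, b) ⟨hxh, hb⟩
    have h2 := hmin _ hxpE
    have hxpR := hnorm _ hxpE.1
    simp only [hk] at h1 h2 hxpR
    have h3 : ⟪d, xh⟫ ≤ ‖d‖ * R := (real_inner_le_norm _ _).trans (by gcongr)
    have h4 : -⟪d, xp⟫ ≤ ‖d‖ * R :=
      (neg_le_abs _).trans ((abs_real_inner_le_norm _ _).trans (by gcongr))
    have h5 : δ * ‖xp‖ ^ 2 ≤ δ * R ^ 2 := by gcongr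
    have h6 : 0 ≤ δ * ‖xh‖ ^ 2 := by positivity
    have h7 : -⟪v, xp - xb⟫ ≤ (‖vh‖ + 1) * (ℓ * D) := by
      refine (neg_le_abs _).trans ((abs_real_inner_le_norm _ _).trans ?_)
      have : ‖v‖ ≤ ‖vh‖ + 1 := by
        have := norm_le_norm_add_norm_sub' v vh
        linarith
      gcongr
    have h8 : μ / 2 * ‖xp - xb‖ ^ 2 ≤ μ / 2 * (ℓ * D) := by
      have : ‖xp - xb‖ ^ 2 ≤ ℓ * D :=
        (pow_le_of_le_one (norm_nonneg _) (hxp.trans hℓD1) two_ne_zero).trans hxp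
      gcongr
    have h9 : ‖v - vh‖ * ρ₁ + C * D + ℓ * D + (‖vh‖ + 1) * (ℓ * D) + μ / 2 * (ℓ * D) ≤ η * M := by
      have e1 : ‖v - vh‖ * ρ₁ ≤ η * ρ₁ := by gcongr
      have e2 : (C + ℓ + (‖vh‖ + 1) * ℓ + μ / 2 * ℓ) * D
          ≤ (C + ℓ + (‖vh‖ + 1) * ℓ + μ / 2 * ℓ) * η := by gcongr
      rw [hM]
      linarith
    have h10 : (μ - r) * ‖xh - xb‖ ^ 2 < (μ - r) * ρ₁ ^ 2 := by
      rw [← hT]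
      linarith
    exact lt_of_pow_lt_pow_left₀ 2 hρ₁.le (lt_of_mul_lt_mul_left h10 (by linarith))
  have hfin : g xh p ≠ ⊤ := ne_top_of_le_ne_top (EReal.coe_ne_top _) hb
  obtain ⟨α, hα⟩ : ∃ α : ℝ, g xh p = α :=
    ⟨(g xh p).toReal, (EReal.coe_toReal hfin (hg_proper xh p)).symm⟩
  refine ⟨xh, (2 : ℝ) • d - (2 * δ) • xh, hinterior.trans hρ₁lt.1, ?_, ?_⟩
  · refine (norm_sub_le _ _).trans ?_
    rw [norm_smul, norm_smul, Real.norm_of_nonneg (by positivity),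
      Real.norm_of_nonneg (by positivity)]
    have : 2 * δ * ‖xh‖ ≤ 2 * δ * R := by gcongr
    linarith
  · refine mem_regSubdiff_of_quadratic_minorant (α := α) (K := μ / 2 + δ)
      (fun u => hg_proper u p) hα ?_
    filter_upwards [isOpen_ball.mem_nhds (mem_ball_iff_norm.2 hinterior)] with u hu a ha
    have h1 := hmin (u, a + k u) ⟨ball_subset_closedBall hu, by simpa using ha⟩
    have h2 : α ≤ b - k xh := by rw [hα] at hb; exact_mod_cast hb
    simp only [hk] at h1 h2
    obtain ⟨y, rfl⟩ : ∃ y, u = xh + y := ⟨u - xh, by abel⟩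
    rw [add_sub_right_comm xh y xb] at h1
    rw [add_sub_cancel_left]
    simp only [norm_add_sq_real, inner_add_right, inner_sub_left, inner_add_left,
      real_inner_smul_left] at h1 h2 ⊢
    linarith

lemma mul_norm_le_of_mul_sq_le_inner {c : ℝ} {w x : X} (h : c * ‖x‖ ^ 2 ≤ ⟪w, x⟫) :
    c * ‖x‖ ≤ ‖w‖ := by
  rcases (norm_nonneg x).eq_or_lt with h0 | h0
  · rw [← h0, mul_zero]; exact norm_nonneg _
  · refine le_of_mul_le_mul_right ?_ h0
    have := real_inner_le_norm w x
    nlinarith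

/-- Lipschitz estimate for the resolvent of a hypomonotone relation. -/
lemma resolvent_lipschitz {r μ : ℝ} {x₁ x₂ v₁ v₂ xb : X}
    (h : -r * ‖x₁ - x₂‖ ^ 2 ≤
      ⟪(v₁ - μ • (x₁ - xb)) - (v₂ - μ • (x₂ - xb)), x₁ - x₂⟫) :
    (μ - r) * ‖x₁ - x₂‖ ≤ ‖v₁ - v₂‖ := by
  apply mul_norm_le_of_mul_sq_le_inner
  have : (v₁ - μ • (x₁ - xb)) - (v₂ - μ • (x₂ - xb)) = (v₁ - v₂) - μ • (x₁ - x₂) := by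
    module
  rw [this, inner_sub_left, real_inner_smul_left, real_inner_self_eq_norm_sq] at h
  linarith

/-- Local solvability of the proximal inclusion, uniformly in the parameter. -/
lemma exists_prox [CompleteSpace X] {g : X → P → EReal} {xb vh : X} {pb : P} {r μ : ℝ}
    (hg_lsc : LowerSemicontinuous fun t : X × P => g t.1 t.2)
    (hg_proper : ∀ x p, g x p ≠ ⊥) (hr : 0 ≤ r) (h : ProxRegWith g xb pb vh r)
    (hcont : SubdiffCont g xb pb vh) (hA3 : A3 g xb pb) (hsub : vh ∈ pSubdiff g xb pb)
    (hμ : r < μ) {ρ : ℝ} (hρ : 0 < ρ) :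
    ∃ η > (0 : ℝ), ∀ p v, dist p pb < η → ‖v - vh‖ < η → ∃ x,
      ‖x - xb‖ < ρ ∧ ‖v - μ • (x - xb) - vh‖ < ρ ∧ v - μ • (x - xb) ∈ pSubdiff g x p := by
  obtain ⟨ε, hε, H⟩ := h.exists_finite_epi hg_proper
  obtain ⟨ρH, hρH, C, hC, mono⟩ := exists_parametric_hypomonotone hg_proper hr h hcont hA3 hsub
  have hμ0 : 0 < μ := hr.trans_lt hμ
  set ρ₀ := min ρ (min ε ρH) with hρ₀
  have hρ₀pos : 0 < ρ₀ := by positivity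
  have hρ₀ρ : ρ₀ ≤ ρ := min_le_left _ _
  have hρ₀ε : ρ₀ ≤ ε := (min_le_right _ _).trans (min_le_left _ _)
  have hρ₀H : ρ₀ ≤ ρH := (min_le_right _ _).trans (min_le_right _ _)
  obtain ⟨ρ₁, hρ₁, hρ₁lt⟩ : ∃ ρ₁ > (0 : ℝ), ρ₁ < min ρ₀ (ρ₀ / (4 * μ)) :=
    exists_between (by positivity)
  rw [lt_min_iff, lt_div_iff₀ (by positivity)] at hρ₁lt
  obtain ⟨η, hη, approx⟩ := exists_approx_prox hg_lsc hg_proper hr h hA3 hsub hμ hρ₁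
  refine ⟨min η (ρ₀ / 4), by positivity, fun p v hp hv => ?_⟩
  simp only [lt_min_iff] at hp hv
  have hpow : ∀ n : ℕ, (0 : ℝ) < ρ₀ / 4 * (1 / 2) ^ n := fun n => by positivity
  choose x w hx hw hreg using fun n : ℕ => approx p v hp.1 hv.1 _ (hpow n)
  set s : ℕ → X := fun n => v + w n - μ • (x n - xb) with hs
  have hs_sub : ∀ n, s n ∈ pSubdiff g (x n) p := fun n =>
    regSubdiff_subset_limSubdiff _ _ (hreg n)
  have near : ∀ y u : X, ‖y - xb‖ ≤ ρ₁ → ‖u‖ ≤ ρ₀ / 4 → ‖v + u - μ • (y - xb) - vh‖ < ρ₀ := by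
    intro y u hy hu
    have e : v + u - μ • (y - xb) - vh = (v - vh) + u - μ • (y - xb) := by abel
    rw [e]
    have h1 := norm_sub_le ((v - vh) + u) (μ • (y - xb))
    have h2 := norm_add_le (v - vh) u
    rw [norm_smul, Real.norm_of_nonneg hμ0.le] at h1
    nlinarith
  have hw4 : ∀ n, ‖w n‖ ≤ ρ₀ / 4 := fun n => (hw n).trans
    (mul_le_of_le_one_right (by positivity) (pow_le_one₀ (by norm_num) (by norm_num)))
  have hp₀ : dist p pb < ρ₀ := by linarith
  have hx₀ : ∀ n, ‖x n - xb‖ < ρ₀ := fun n => (hx n).trans hρ₁lt.1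
  have hs₀ : ∀ n, ‖s n - vh‖ < ρ₀ := fun n => near _ _ (hx n).le (hw4 n)
  have x_step : ∀ n, dist (x n) (x (n + 1)) ≤ (ρ₀ / 2 / (μ - r)) * (1 / 2) ^ n := by
    intro n
    have h1 := mono (x n) p (s n) (x (n + 1)) p (s (n + 1)) (by linarith [hx₀ n]) (by linarith)
      (by linarith [hs₀ n]) (hs_sub n) (by linarith [hx₀ (n + 1)]) (by linarith)
      (by linarith [hs₀ (n + 1)]) (hs_sub _)
    rw [dist_self, mul_zero, sub_zero] at h1
    have h2 := resolvent_lipschitz h1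
    rw [add_sub_add_left_eq_sub] at h2
    have h3 := norm_sub_le (w n) (w (n + 1))
    have h4 := hw (n + 1)
    rw [pow_succ] at h4
    have h5 : (0 : ℝ) < ρ₀ * (1 / 2) ^ n := by positivity
    rw [dist_eq_norm, div_mul_eq_mul_div, le_div_iff₀ (by linarith)]
    linarith [hw n]
  obtain ⟨xl, hxl⟩ := cauchySeq_tendsto_of_complete
    (cauchySeq_of_le_geometric _ _ (by norm_num : (1 / 2 : ℝ) < 1) x_step)
  have hwlim : Tendsto w atTop (𝓝 0) := by
    refine squeeze_zero_norm hw ?_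
    simpa using (tendsto_pow_atTop_nhds_zero_of_lt_one (r := (1 / 2 : ℝ)) (by norm_num)
      (by norm_num)).const_mul (ρ₀ / 4)
  have hslim : Tendsto s atTop (𝓝 (v - μ • (xl - xb))) := by
    have := (hwlim.const_add v).sub ((hxl.sub_const xb).const_smul μ)
    simpa using this
  have hxlb : ‖xl - xb‖ ≤ ρ₁ :=
    le_of_tendsto (hxl.sub_const xb).norm (Eventually.of_forall fun n => (hx n).le)
  have hslb : ‖v - μ • (xl - xb) - vh‖ < ρ₀ := by
    simpa using near xl 0 hxlb (by rw [norm_zero]; positivity)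
  have hlimit : ∀ y (a : ℝ), ‖y - xb‖ < ε → g y p ≤ a →
      g xl p ≤ ((a - ⟪v - μ • (xl - xb), y - xl⟫ + r / 2 * ‖y - xl‖ ^ 2 : ℝ) : EReal) := by
    intro y a hy ha
    have hclosed := (hg_lsc.comp (Continuous.prodMk_left p)).isClosed_epigraph
    have hyx := hxl.const_sub y
    have hreal := ((hslim.inner hyx).const_sub a).add ((hyx.norm.pow 2).const_mul (r / 2))
    have hpair := hxl.prodMk_nhds ((continuous_coe_real_ereal.tendsto _).comp hreal)
    refine hclosed.mem_of_tendsto hpair (Eventually.of_forall fun n => ?_)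
    obtain ⟨α, hα, hmin⟩ := H (x n) p (s n) (by linarith [hx₀ n]) (by linarith)
      (by linarith [hs₀ n]) (hs_sub n)
    have := hmin y a hy ha
    change g (x n) p ≤ ((a - ⟪s n, y - x n⟫ + r / 2 * ‖y - x n‖ ^ 2 : ℝ) : EReal)
    rw [hα]
    norm_cast
    linarith
  obtain ⟨α₀, hα₀, -⟩ := H (x 0) p (s 0) (by linarith [hx₀ 0]) (by linarith)
    (by linarith [hs₀ 0]) (hs_sub 0)
  have hfin : g xl p ≠ ⊤ := ne_top_of_le_ne_top (EReal.coe_ne_top _)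
    (hlimit (x 0) α₀ (by linarith [hx₀ 0]) hα₀.le)
  obtain ⟨α, hα⟩ : ∃ α : ℝ, g xl p = α :=
    ⟨(g xl p).toReal, (EReal.coe_toReal hfin (hg_proper xl p)).symm⟩
  refine ⟨xl, by linarith, by linarith, regSubdiff_subset_limSubdiff _ _ ?_⟩
  refine mem_regSubdiff_of_quadratic_minorant (K := r / 2) (fun u => hg_proper u p) hα ?_
  filter_upwards [isOpen_ball.mem_nhds (mem_ball_iff_norm.2 (by linarith : ‖xl - xb‖ < ε))]
    with u hu a ha
  have := hlimit u a (mem_ball_iff_norm.1 hu) ha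
  rw [hα] at this
  norm_cast at this
  linarith

/-- Regular coderivatives of a hypomonotone relation with a locally solvable resolvent satisfy
the corresponding lower bound. -/
lemma le_inner_of_mem_regCoderiv {F : X → Set X} {u v w z : X} {r μ τ : ℝ} (hr : 0 ≤ r)
    (hμ : r < μ) (hτ : 0 < τ)
    (hres : ∀ y, ‖y‖ < τ → ∃ x s, s ∈ F x ∧ (s - v) + μ • (x - u) = y ∧
      -r * ‖x - u‖ ^ 2 ≤ ⟪s - v, x - u⟫)
    (hz : z ∈ regCoderiv F u v w) : -r * ‖w‖ ^ 2 ≤ ⟪z, w⟫ := by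
  have hα : 0 < μ - r := by linarith
  obtain ⟨Z, hZ⟩ : ∃ Z : X, z = (μ - r) • Z - r • w :=
    ⟨(μ - r)⁻¹ • (z + r • w), by rw [smul_inv_smul₀ hα.ne', add_sub_cancel_right]⟩
  suffices h : ‖Z - w‖ ≤ ‖Z + w‖ by
    have h1 : ‖Z - w‖ ^ 2 ≤ ‖Z + w‖ ^ 2 := by gcongr
    rw [norm_sub_sq_real, norm_add_sq_real] at h1
    rw [hZ, inner_sub_left, real_inner_smul_left, real_inner_smul_left, real_inner_self_eq_norm_sq]
    have : 0 ≤ (μ - r) * ⟪Z, w⟫ := mul_nonneg hα.le (by linarith)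
    linarith
  rcases (norm_nonneg (Z - w)).eq_or_lt with h0 | hb
  · rw [← h0]; exact norm_nonneg _
  set K := 1 / (μ - r) + (1 + r / (μ - r)) with hK
  have hKpos : 0 < K := by positivity
  refine le_of_forall_pos_le_add fun ε hε => ?_
  have hev := hz (ε / (2 * K)) (by positivity)
  obtain ⟨ε', hε', hball⟩ := Metric.mem_nhdsWithin_iff.1 hev
  obtain ⟨t, ht, htlt⟩ : ∃ t > (0 : ℝ), t < min (τ / ‖Z - w‖) (ε' / (K * ‖Z - w‖)) :=
    exists_between (by positivity)
  rw [lt_min_iff, lt_div_iff₀ hb, lt_div_iff₀ (by positivity)] at htlt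
  have hy : ‖t • (Z - w)‖ = t * ‖Z - w‖ := by rw [norm_smul, Real.norm_of_nonneg ht.le]
  obtain ⟨x, s, hs, hxs, hmono⟩ := hres (t • (Z - w)) (by rw [hy]; exact htlt.1)
  set dx := x - u with hdx
  set dm := (s - v) + r • dx with hdm
  have hsv : s - v = dm - r • dx := by rw [hdm]; abel
  have hsum : (μ - r) • dx + dm = t • (Z - w) := by rw [← hxs, hdm]; module
  have hpos : 0 ≤ ⟪(μ - r) • dx, dm⟫ := by
    rw [real_inner_smul_left]
    refine mul_nonneg hα.le ?_
    rw [hdm, inner_add_right, real_inner_smul_right, real_inner_self_eq_norm_sq, real_inner_comm]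
    linarith
  have hsq : ‖t • (Z - w)‖ ^ 2 =
      ‖(μ - r) • dx‖ ^ 2 + 2 * ⟪(μ - r) • dx, dm⟫ + ‖dm‖ ^ 2 := by
    rw [← hsum, norm_add_sq_real]
  have hdxle : (μ - r) * ‖dx‖ ≤ t * ‖Z - w‖ := by
    rw [← hy, ← Real.norm_of_nonneg hα.le, ← norm_smul]
    refine le_of_sq_le_sq ?_ (norm_nonneg _)
    nlinarith [sq_nonneg ‖dm‖]
  have hdmle : ‖dm‖ ≤ t * ‖Z - w‖ := by
    rw [← hy]
    refine le_of_sq_le_sq ?_ (norm_nonneg _)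
    nlinarith [sq_nonneg ‖(μ - r) • dx‖]
  have hele : ‖(μ - r) • dx - dm‖ ≤ t * ‖Z - w‖ := by
    rw [← hy]
    refine le_of_sq_le_sq ?_ (norm_nonneg _)
    rw [norm_sub_sq_real]
    linarith
  have hdx' : ‖dx‖ ≤ 1 / (μ - r) * (t * ‖Z - w‖) := by
    rw [div_mul_eq_mul_div, le_div_iff₀ hα]; linarith
  have hsv' : ‖s - v‖ ≤ (1 + r / (μ - r)) * (t * ‖Z - w‖) := by
    have h1 : ‖s - v‖ ≤ ‖dm‖ + r * ‖dx‖ := by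
      rw [hsv]
      refine (norm_sub_le _ _).trans ?_
      rw [norm_smul, Real.norm_of_nonneg hr]
    have h2 : r * ‖dx‖ ≤ r * (1 / (μ - r) * (t * ‖Z - w‖)) := by gcongr
    have h3 : r * (1 / (μ - r) * (t * ‖Z - w‖)) = r / (μ - r) * (t * ‖Z - w‖) := by ring
    linarith
  have hsumle : ‖dx‖ + ‖s - v‖ ≤ K * (t * ‖Z - w‖) := by rw [hK]; linarith
  have hmem : ((x, s) : X × X) ∈ ball (u, v) ε' ∩ gph F := by
    refine ⟨?_, hs⟩
    rw [mem_ball, Prod.dist_eq, max_lt_iff, dist_eq_norm, dist_eq_norm]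
    have h1 := norm_nonneg dx
    have h2 := norm_nonneg (s - v)
    constructor <;> nlinarith
  have hfinal := hball hmem
  simp only [mem_ofPred_eq, inner_neg_left] at hfinal
  have hsqrt : √(‖x - u‖ ^ 2 + ‖s - v‖ ^ 2) ≤ K * (t * ‖Z - w‖) := by
    refine (Real.sqrt_le_left (by positivity)).2 ?_ |>.trans hsumle
    nlinarith [mul_nonneg (norm_nonneg dx) (norm_nonneg (s - v))]
  have h1 : ⟪z, x - u⟫ + -⟪w, s - v⟫ ≤ ε / 2 * (t * ‖Z - w‖) := by
    refine hfinal.trans ?_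
    calc ε / (2 * K) * √(‖x - u‖ ^ 2 + ‖s - v‖ ^ 2)
        ≤ ε / (2 * K) * (K * (t * ‖Z - w‖)) := by gcongr
      _ = ε / 2 * (t * ‖Z - w‖) := by field_simp
  have h2 : 2 * (⟪z, x - u⟫ + -⟪w, s - v⟫) =
      ⟪Z - w, t • (Z - w)⟫ + ⟪Z + w, (μ - r) • dx - dm⟫ := by
    rw [← hsum, hsv, hZ]
    simp only [inner_sub_left, inner_add_left, inner_sub_right, inner_add_right,
      real_inner_smul_left, real_inner_smul_right, ← hdx]
    ring
  have h3 : -(‖Z + w‖ * (t * ‖Z - w‖)) ≤ ⟪Z + w, (μ - r) • dx - dm⟫ := by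
    have := (abs_le.1 (abs_real_inner_le_norm (Z + w) ((μ - r) • dx - dm))).1
    have : ‖Z + w‖ * ‖(μ - r) • dx - dm‖ ≤ ‖Z + w‖ * (t * ‖Z - w‖) := by gcongr
    linarith
  rw [real_inner_smul_right, real_inner_self_eq_norm_sq] at h2
  refine le_of_mul_le_mul_right ?_ (mul_pos ht hb)
  nlinarith

lemma StrongMono.le_inner_deriv {f : X → P → Q → X} {Df : X → P → Q → X →L[ℝ] X} {xb : X} {pb : P}
    {qb : Q} {σ : ℝ} (hmono : StrongMono f xb pb qb σ) (hA4 : A4 f Df xb pb qb) (w : X) :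
    σ * ‖w‖ ^ 2 ≤ ⟪Df xb pb qb w, w⟫ := by
  obtain ⟨ε₁, hε₁, hmono⟩ := hmono
  obtain ⟨⟨η, hη, hdiff⟩, -⟩ := hA4
  refine le_of_forall_pos_le_add fun ε hε => ?_
  obtain ⟨δ, hδ, hdiff⟩ := hdiff (ε / (‖w‖ ^ 2 + 1)) (by positivity)
  obtain ⟨t, ht, htlt⟩ : ∃ t > (0 : ℝ), t < min (ε₁ / (‖w‖ + 1)) (δ / (‖w‖ + 1)) :=
    exists_between (by positivity)
  rw [lt_min_iff, lt_div_iff₀ (by positivity), lt_div_iff₀ (by positivity)] at htlt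
  have hn : ‖t • w‖ = t * ‖w‖ := by rw [norm_smul, Real.norm_of_nonneg ht.le]
  have h1 := hmono (xb + t • w) xb pb qb (by rw [add_sub_cancel_left, hn]; linarith) (by simpa)
    (by simpa) (by simpa)
  have h2 := hdiff xb pb qb (by simpa) (by simpa) (by simpa) (xb + t • w)
    (by rw [add_sub_cancel_left, hn]; linarith)
  rw [add_sub_cancel_left] at h1 h2
  have h3 := real_inner_le_norm
    (f (xb + t • w) pb qb - f xb pb qb - Df xb pb qb (t • w)) (t • w)
  have h4 : ‖f (xb + t • w) pb qb - f xb pb qb - Df xb pb qb (t • w)‖ * ‖t • w‖ ≤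
      ε / (‖w‖ ^ 2 + 1) * ‖t • w‖ * ‖t • w‖ := by gcongr
  simp only [inner_sub_left, map_smul, real_inner_smul_left, real_inner_smul_right] at h1 h3
  have h5 : ε / (‖w‖ ^ 2 + 1) * ‖t • w‖ * ‖t • w‖ ≤ t * t * ε := by
    rw [hn, div_mul_eq_mul_div, div_mul_eq_mul_div, div_le_iff₀ (by positivity)]
    nlinarith [mul_pos (mul_pos ht ht) hε]
  rw [hn] at h1
  rw [map_smul] at h4
  refine le_of_mul_le_mul_left ?_ (mul_pos ht ht)
  linarith only [h1, h3, h4, h5]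

/-- Neighborhood second-order condition for strongly monotone perturbations of the
subdifferential of a prox-regular function. -/
lemma exists_SOC [CompleteSpace X] {g : X → P → EReal} {A : X →L[ℝ] X} {xb vh : X} {pb : P}
    {r σ : ℝ} (hg_lsc : LowerSemicontinuous fun t : X × P => g t.1 t.2)
    (hg_proper : ∀ x p, g x p ≠ ⊥) (hr : 0 ≤ r) (h : ProxRegWith g xb pb vh r)
    (hcont : SubdiffCont g xb pb vh) (hA3 : A3 g xb pb) (hsub : vh ∈ pSubdiff g xb pb)
    (hA : ∀ w, σ * ‖w‖ ^ 2 ≤ ⟪A w, w⟫) :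
    ∃ η > (0 : ℝ), SOC g A xb pb vh η (σ - r) := by
  obtain ⟨ρ, hρ, C, -, mono⟩ := exists_parametric_hypomonotone hg_proper hr h hcont hA3 hsub
  obtain ⟨η, hη, prox⟩ := exists_prox hg_lsc hg_proper hr h hcont hA3 hsub
    (lt_add_one r) hρ
  obtain ⟨η₀, hη₀, hlt⟩ : ∃ η₀ > (0 : ℝ), η₀ < min ρ (η / (2 * (1 + (r + 1)))) :=
    exists_between (by positivity)
  rw [lt_min_iff, lt_div_iff₀ (by positivity)] at hlt
  refine ⟨η₀, hη₀, fun u p v hu hp hv hvs w z hz => ?_⟩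
  have key : -r * ‖w‖ ^ 2 ≤ ⟪z, w⟫ := by
    refine le_inner_of_mem_regCoderiv hr (lt_add_one r) (half_pos hη) (fun y hy => ?_) hz
    obtain ⟨x, hx, hs, hxs⟩ := prox p (v + (r + 1) • (u - xb) + y) (by nlinarith) (by
      have e : v + (r + 1) • (u - xb) + y - vh = (v - vh) + (r + 1) • (u - xb) + y := by abel
      rw [e]
      have h1 := norm_add₃_le (a := v - vh) (b := (r + 1) • (u - xb)) (c := y)
      rw [norm_smul, Real.norm_of_nonneg (by positivity)] at h1
      nlinarith)
    refine ⟨x, _, hxs, by module, ?_⟩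
    have := mono x p _ u p v hx (by linarith) hs hxs (by linarith) (by linarith) (by linarith) hvs
    rwa [dist_self, mul_zero, sub_zero] at this
  linarith [hA w]

/-- Shifting by a multiple of a strongly monotone Lipschitz map contracts faster than the
resolvent of a less hypomonotone relation expands. -/
lemma exists_contraction_factor {r σ L : ℝ} (hr : 0 ≤ r) (hrσ : r < σ) :
    ∃ μ > r, ∃ K : ℝ, 0 ≤ K ∧ K < 1 ∧ ∀ a b : X, ‖b‖ ≤ L * ‖a‖ → σ * ‖a‖ ^ 2 ≤ ⟪b, a⟫ →
      ‖μ • a - b‖ ≤ (μ - r) * (K * ‖a‖) := by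
  have hσr : 0 < σ - r := by linarith
  set μ := r + 1 + L ^ 2 / (σ - r) with hμ
  have hμr : r < μ := by
    have : 0 ≤ L ^ 2 / (σ - r) := by positivity
    linarith
  have hpos : 0 < (μ - r) ^ 2 := pow_pos (by linarith) 2
  have hprod : (σ - r) * μ = (σ - r) * (r + 1) + L ^ 2 := by rw [hμ]; field_simp
  set q := (μ ^ 2 - 2 * σ * μ + L ^ 2) / (μ - r) ^ 2 with hq
  have hq1 : q < 1 := by
    rw [hq, div_lt_one hpos]
    nlinarith [mul_pos hσr (by linarith : 0 < r + 1)]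
  refine ⟨μ, hμr, √q, Real.sqrt_nonneg _, (Real.sqrt_lt' one_pos).2 (by simpa using hq1),
    fun a b hb hab => ?_⟩
  refine le_of_sq_le_sq ?_
    (mul_nonneg (by linarith) (mul_nonneg (Real.sqrt_nonneg _) (norm_nonneg _)))
  have hq2 : μ ^ 2 - 2 * σ * μ + L ^ 2 ≤ (μ - r) ^ 2 * √q ^ 2 := by
    rw [Real.sq_sqrt', mul_comm ((μ - r) ^ 2), ← div_le_iff₀ hpos]
    exact le_max_left _ _
  have hb2 : ‖b‖ ^ 2 ≤ L ^ 2 * ‖a‖ ^ 2 := by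
    rw [← mul_pow]; gcongr
  have hab2 : 2 * μ * (σ * ‖a‖ ^ 2) ≤ 2 * μ * ⟪b, a⟫ :=
    mul_le_mul_of_nonneg_left hab (by linarith)
  rw [norm_sub_sq_real, norm_smul, real_inner_smul_left, real_inner_comm, mul_pow, mul_pow,
    mul_pow, Real.norm_eq_abs, sq_abs]
  nlinarith [mul_le_mul_of_nonneg_right hq2 (sq_nonneg ‖a‖)]

lemma A1.exists_bounds {f : X → P → Q → X} {xb : X} {pb : P} {qb : Q} {σ : ℝ}
    (hA1 : A1 f xb pb qb) (hmono : StrongMono f xb pb qb σ) :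
    ∃ L > (0 : ℝ), ∃ ε > (0 : ℝ),
      (∀ x₁ x₂ p₁ p₂ q₁ q₂, ‖x₁ - xb‖ < ε → ‖x₂ - xb‖ < ε → dist p₁ pb < ε → dist p₂ pb < ε →
        dist q₁ qb < ε → dist q₂ qb < ε →
        ‖f x₁ p₁ q₁ - f x₂ p₂ q₂‖ ≤ L * (‖x₁ - x₂‖ + dist p₁ p₂ + dist q₁ q₂)) ∧
      (∀ x₁ x₂ p q, ‖x₁ - xb‖ < ε → ‖x₂ - xb‖ < ε → dist p pb < ε → dist q qb < ε →
        σ * ‖x₁ - x₂‖ ^ 2 ≤ ⟪f x₁ p q - f x₂ p q, x₁ - x₂⟫) := by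
  obtain ⟨L, hL, ε₁, hε₁, H₁⟩ := hA1
  obtain ⟨ε₂, hε₂, H₂⟩ := hmono
  refine ⟨L, hL, min ε₁ ε₂, by positivity, ?_, ?_⟩
  · intro x₁ x₂ p₁ p₂ q₁ q₂ h1 h2 h3 h4 h5 h6
    simp only [lt_min_iff] at h1 h2 h3 h4 h5 h6
    exact H₁ x₁ x₂ p₁ p₂ q₁ q₂ h1.1 h2.1 h3.1 h4.1 h5.1 h6.1
  · intro x₁ x₂ p q h1 h2 h3 h4
    simp only [lt_min_iff] at h1 h2 h3 h4
    exact H₂ x₁ x₂ p q h1.2 h2.2 h3.2 h4.2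

/-- Local solvability of the parametric variational system. -/
lemma exists_solution [CompleteSpace X] {f : X → P → Q → X} {g : X → P → EReal} {xb vb vh : X}
    {pb : P} {qb : Q} {r σ : ℝ} (hg_lsc : LowerSemicontinuous fun t : X × P => g t.1 t.2)
    (hg_proper : ∀ x p, g x p ≠ ⊥) (hvh : vh = vb - f xb pb qb) (hr : 0 ≤ r)
    (h : ProxRegWith g xb pb vh r) (hcont : SubdiffCont g xb pb vh) (hA3 : A3 g xb pb)
    (hsub : vh ∈ pSubdiff g xb pb) (hA1 : A1 f xb pb qb) (hmono : StrongMono f xb pb qb σ)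
    (hrσ : r < σ) {ρ : ℝ} (hρ : 0 < ρ) :
    ∃ η > (0 : ℝ), ∀ v p q, ‖v - vb‖ < η → dist p pb < η → dist q qb < η →
      ∃ x, ‖x - xb‖ < ρ ∧ x ∈ SolMap f g v p q := by
  obtain ⟨L, hL, ε, hε, hLip, hmon⟩ := hA1.exists_bounds hmono
  obtain ⟨μ, hμ, K, hK0, hK1, hcontr⟩ := exists_contraction_factor (X := X) (L := L) hr hrσ
  have hμ0 : 0 < μ := hr.trans_lt hμ
  obtain ⟨ρH, hρH, C, -, mono⟩ := exists_parametric_hypomonotone hg_proper hr h hcont hA3 hsub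
  obtain ⟨η₁, hη₁, prox₁⟩ := exists_prox hg_lsc hg_proper hr h hcont hA3 hsub hμ hρH
  obtain ⟨ρ₁, hρ₁, hlt⟩ : ∃ ρ₁ > (0 : ℝ), ρ₁ < min (min ρ ε) (η₁ / (2 * (μ + L))) :=
    exists_between (by positivity)
  simp only [lt_min_iff] at hlt
  obtain ⟨⟨hρ₁ρ, hρ₁ε⟩, hρ₁η⟩ := hlt
  rw [lt_div_iff₀ (by positivity)] at hρ₁η
  have hK : 0 < 1 - K := by linarith
  obtain ⟨η₂, hη₂, prox₂⟩ := exists_prox hg_lsc hg_proper hr h hcont hA3 hsub hμ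
    (by positivity : 0 < min ρH ((1 - K) * ρ₁))
  obtain ⟨η, hη, hlt⟩ : ∃ η > (0 : ℝ), η < min (min (min η₁ η₂) (min ρH ε))
      (min (η₁ / (2 * (1 + 2 * L))) (η₂ / (1 + 2 * L))) := exists_between (by positivity)
  simp only [lt_min_iff] at hlt
  obtain ⟨⟨⟨hηη₁, hηη₂⟩, hηH, hηε⟩, hη3, hη4⟩ := hlt
  rw [lt_div_iff₀ (by positivity)] at hη3 hη4
  refine ⟨η, hη, fun v p q hv hp hq => ?_⟩
  set y : X → X := fun x => v - f x p q + μ • (x - xb) with hy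
  have hyb : ∀ x, ‖x - xb‖ ≤ ρ₁ → ‖y x - vh‖ ≤ (1 + 2 * L) * η + (μ + L) * ‖x - xb‖ := by
    intro x hx
    have e : y x - vh = (v - vb) + -(f x p q - f xb pb qb) + μ • (x - xb) := by
      rw [hy, hvh]; simp only; abel
    rw [e]
    have h1 := norm_add₃_le (a := v - vb) (b := -(f x p q - f xb pb qb)) (c := μ • (x - xb))
    rw [norm_smul, Real.norm_of_nonneg hμ0.le, norm_neg] at h1
    have h2 := hLip x xb p pb q qb (by linarith) (by simpa) (by linarith) (by simpa) (by linarith)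
      (by simpa)
    nlinarith
  set good : X → X → Prop := fun x b => ‖b - xb‖ < ρH ∧ ‖y x - μ • (b - xb) - vh‖ < ρH ∧
    y x - μ • (b - xb) ∈ pSubdiff g b p with hgood
  have hgoodLip : ∀ x₁ x₂ b₁ b₂, ‖x₁ - xb‖ ≤ ρ₁ → ‖x₂ - xb‖ ≤ ρ₁ → good x₁ b₁ → good x₂ b₂ →
      ‖b₁ - b₂‖ ≤ K * ‖x₁ - x₂‖ := by
    rintro x₁ x₂ b₁ b₂ hx₁ hx₂ ⟨g₁, g₂, g₃⟩ ⟨g₁', g₂', g₃'⟩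
    have h1 := mono b₁ p _ b₂ p _ g₁ (by linarith) g₂ g₃ g₁' (by linarith) g₂' g₃'
    rw [dist_self, mul_zero, sub_zero] at h1
    have h2 := resolvent_lipschitz h1
    have h3 : y x₁ - y x₂ = μ • (x₁ - x₂) - (f x₁ p q - f x₂ p q) := by
      simp only [hy]; module
    have h4 := hLip x₁ x₂ p p q q (by linarith) (by linarith) (by linarith) (by linarith)
      (by linarith) (by linarith)
    rw [dist_self, dist_self, add_zero, add_zero] at h4
    have h5 := hcontr _ _ h4
      (hmon x₁ x₂ p q (by linarith) (by linarith) (by linarith) (by linarith))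
    rw [← h3] at h5
    exact le_of_mul_le_mul_left (h2.trans h5) (by linarith)
  have hex : ∀ x, x ∈ closedBall xb ρ₁ → ∃ b, good x b := by
    intro x hx
    rw [mem_closedBall, dist_eq_norm] at hx
    refine prox₁ p (y x) (by linarith) ((hyb x hx).trans_lt ?_)
    nlinarith
  choose! T hT using hex
  obtain ⟨b₀, hb₀, hb₀', hb₀s⟩ := prox₂ p (y xb) (by linarith)
    ((hyb xb (by simpa using hρ₁.le)).trans_lt (by rw [sub_self, norm_zero]; linarith))
  rw [lt_min_iff] at hb₀ hb₀'
  have hmaps : MapsTo T (closedBall xb ρ₁) (closedBall xb ρ₁) := by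
    intro x hx
    have hTx := hT x hx
    rw [mem_closedBall, dist_eq_norm] at hx ⊢
    have h1 := hgoodLip x xb (T x) b₀ hx (by simpa using hρ₁.le) hTx ⟨hb₀.1, hb₀'.1, hb₀s⟩
    have h2 := norm_sub_le_norm_sub_add_norm_sub (T x) b₀ xb
    have h3 : K * ‖x - xb‖ ≤ K * ρ₁ := by gcongr
    linarith [hb₀.2]
  have hcon : ContractingWith ⟨K, hK0⟩ (hmaps.restrict T _ _) := by
    refine ⟨by exact_mod_cast hK1, LipschitzWith.of_dist_le_mul fun x₁ x₂ => ?_⟩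
    have := hgoodLip x₁ x₂ _ _ (mem_closedBall_iff_norm.1 x₁.2) (mem_closedBall_iff_norm.1 x₂.2)
      (hT _ x₁.2) (hT _ x₂.2)
    rw [Subtype.dist_eq, Subtype.dist_eq, dist_eq_norm, dist_eq_norm]
    exact this
  obtain ⟨x, hx, hfix, -⟩ := hcon.exists_fixedPoint' isClosed_closedBall.isComplete hmaps
    (mem_closedBall_self hρ₁.le) (edist_ne_top _ _)
  refine ⟨x, (mem_closedBall_iff_norm.1 hx).trans_lt hρ₁ρ, ?_⟩
  have hsol := (hT x hx).2.2
  rw [hfix.eq] at hsol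
  simpa [hy, SolMap] using hsol

/-- One-sided estimate for solutions with a square-root type dependence on the parameter `p`. -/
lemma exists_solution_estimate {f : X → P → Q → X} {g : X → P → EReal} {xb vb vh : X}
    {pb : P} {qb : Q} {r σ : ℝ} (hg_proper : ∀ x p, g x p ≠ ⊥) (hvh : vh = vb - f xb pb qb)
    (hr : 0 ≤ r) (h : ProxRegWith g xb pb vh r) (hcont : SubdiffCont g xb pb vh)
    (hA3 : A3 g xb pb) (hsub : vh ∈ pSubdiff g xb pb) (hA1 : A1 f xb pb qb)
    (hmono : StrongMono f xb pb qb σ) (hrσ : r < σ) :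
    ∃ ρ > (0 : ℝ), ∃ C > (0 : ℝ), ∀ v₁ p₁ q₁ x₁ v₂ p₂ q₂ x₂,
      ‖v₁ - vb‖ < ρ → dist p₁ pb < ρ → dist q₁ qb < ρ → ‖x₁ - xb‖ < ρ → x₁ ∈ SolMap f g v₁ p₁ q₁ →
      ‖v₂ - vb‖ < ρ → dist p₂ pb < ρ → dist q₂ qb < ρ → ‖x₂ - xb‖ < ρ → x₂ ∈ SolMap f g v₂ p₂ q₂ →
        (σ - r) / 2 * ‖x₁ - x₂‖ ^ 2 - C * (dist p₁ p₂ + dist q₁ q₂ ^ 2)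
          ≤ ⟪v₁ - v₂, x₁ - x₂⟫ := by
  obtain ⟨L, hL, ε, hε, hLip, hmon⟩ := hA1.exists_bounds hmono
  obtain ⟨ρH, hρH, C, hC, mono⟩ := exists_parametric_hypomonotone hg_proper hr h hcont hA3 hsub
  obtain ⟨ρ, hρ, hlt⟩ : ∃ ρ > (0 : ℝ), ρ < min (min ε ρH) (min (1 / 2) (ρH / (1 + 3 * L))) :=
    exists_between (by positivity)
  simp only [lt_min_iff] at hlt
  obtain ⟨⟨hρε, hρH'⟩, hρh, hρL⟩ := hlt
  rw [lt_div_iff₀ (by positivity)] at hρL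
  set κ := (σ - r) / 2 with hκ
  have hκpos : 0 < κ := by rw [hκ]; linarith
  refine ⟨ρ, hρ, C + L + L ^ 2 / (4 * κ), by positivity, ?_⟩
  intro v₁ p₁ q₁ x₁ v₂ p₂ q₂ x₂ hv₁ hp₁ hq₁ hx₁ hs₁ hv₂ hp₂ hq₂ hx₂ hs₂
  have near : ∀ v p q x, ‖v - vb‖ < ρ → dist p pb < ρ → dist q qb < ρ → ‖x - xb‖ < ρ →
      ‖(v - f x p q) - vh‖ < ρH := by
    intro v p q x hv hp hq hx
    have e : (v - f x p q) - vh = (v - vb) - (f x p q - f xb pb qb) := by rw [hvh]; abel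
    rw [e]
    have h1 := norm_sub_le (v - vb) (f x p q - f xb pb qb)
    have h2 := hLip x xb p pb q qb (by linarith) (by simpa) (by linarith) (by simpa) (by linarith)
      (by simpa)
    nlinarith
  have h1 := mono x₁ p₁ _ x₂ p₂ _ (by linarith) (by linarith) (near v₁ p₁ q₁ x₁ hv₁ hp₁ hq₁ hx₁) hs₁
    (by linarith) (by linarith) (near v₂ p₂ q₂ x₂ hv₂ hp₂ hq₂ hx₂) hs₂
  have h2 := hmon x₁ x₂ p₁ q₁ (by linarith) (by linarith) (by linarith) (by linarith)
  have h3 := hLip x₂ x₂ p₁ p₂ q₁ q₂ (by linarith) (by linarith) (by linarith) (by linarith)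
    (by linarith) (by linarith)
  rw [sub_self, norm_zero, zero_add] at h3
  set b := x₁ - x₂ with hb
  have hb1 : ‖b‖ ≤ 1 := by
    have := norm_sub_le_norm_sub_add_norm_sub x₁ xb x₂
    rw [norm_sub_rev xb x₂] at this
    linarith
  have h4 := (abs_le.1 (abs_real_inner_le_norm (f x₂ p₁ q₁ - f x₂ p₂ q₂) b)).1
  have h5 : ‖f x₂ p₁ q₁ - f x₂ p₂ q₂‖ * ‖b‖ ≤ L * (dist p₁ p₂ + dist q₁ q₂) * ‖b‖ := by gcongr
  have h6 : L * dist p₁ p₂ * ‖b‖ ≤ L * dist p₁ p₂ := mul_le_of_le_one_right (by positivity) hb1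
  have h7 : L * dist q₁ q₂ * ‖b‖ ≤ κ * ‖b‖ ^ 2 + L ^ 2 / (4 * κ) * dist q₁ q₂ ^ 2 := by
    have e : κ * ‖b‖ ^ 2 + L ^ 2 / (4 * κ) * dist q₁ q₂ ^ 2 - L * dist q₁ q₂ * ‖b‖
        = (2 * κ * ‖b‖ - L * dist q₁ q₂) ^ 2 / (4 * κ) := by field_simp; ring
    have : 0 ≤ (2 * κ * ‖b‖ - L * dist q₁ q₂) ^ 2 / (4 * κ) := by positivity
    linarith
  have e : ⟪v₁ - v₂, b⟫ = ⟪v₁ - f x₁ p₁ q₁ - (v₂ - f x₂ p₂ q₂), b⟫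
      + ⟪f x₁ p₁ q₁ - f x₂ p₁ q₁, b⟫ + ⟪f x₂ p₁ q₁ - f x₂ p₂ q₂, b⟫ := by
    rw [← inner_add_left, ← inner_add_left]; congr 1; abel
  have h8 : 0 ≤ (L ^ 2 / (4 * κ)) * dist p₁ p₂ := by positivity
  have h9 : 0 ≤ (C + L) * dist q₁ q₂ ^ 2 := by positivity
  have h10 : σ * ‖b‖ ^ 2 = (2 * κ + r) * ‖b‖ ^ 2 := by rw [hκ]; ring
  rw [e]
  linarith

lemma holder_norm_estimate {a b : X} {κ C s t : ℝ} (hκ : 0 < κ) (hC : 0 < C) (hs : 0 ≤ s)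
    (ht : 0 ≤ t) (h : κ * ‖b‖ ^ 2 - C * (s + t ^ 2) ≤ ⟪a, b⟫) :
    ‖a - (2 * κ) • b‖ ≤ ‖a‖ + (4 * κ * C + 1) * (√s + t) := by
  refine le_of_sq_le_sq ?_ (by positivity)
  have h1 : s + t ^ 2 ≤ (√s + t) ^ 2 := by
    nlinarith [Real.sq_sqrt hs, mul_nonneg (Real.sqrt_nonneg s) ht]
  have hκC : 0 < κ * C := by positivity
  have h2 : 4 * (κ * C) * (s + t ^ 2) ≤ (4 * κ * C + 1) ^ 2 * (√s + t) ^ 2 := by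
    have : 4 * (κ * C) ≤ (4 * κ * C + 1) ^ 2 := by nlinarith
    gcongr
  have h3 : 4 * κ * (κ * ‖b‖ ^ 2 - C * (s + t ^ 2)) ≤ 4 * κ * ⟪a, b⟫ := by gcongr
  have h4 : 0 ≤ ‖a‖ * ((4 * κ * C + 1) * (√s + t)) := by positivity
  rw [norm_sub_sq_real, norm_smul, real_inner_smul_right, mul_pow, Real.norm_eq_abs, sq_abs]
  linarith

lemma holderFullStable_of_strongMono [CompleteSpace X] {f : X → P → Q → X} {g : X → P → EReal}
    {xb vb vh : X} {pb : P} {qb : Q} {r σ : ℝ}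
    (hg_lsc : LowerSemicontinuous fun t : X × P => g t.1 t.2)
    (hg_proper : ∀ x p, g x p ≠ ⊥) (hvh : vh = vb - f xb pb qb) (hr : 0 ≤ r)
    (h : ProxRegWith g xb pb vh r) (hcont : SubdiffCont g xb pb vh) (hA3 : A3 g xb pb)
    (hsub : vh ∈ pSubdiff g xb pb) (hA1 : A1 f xb pb qb) (hmono : StrongMono f xb pb qb σ)
    (hrσ : r < σ) : HolderFullStable (SolMap f g) xb vb pb qb := by
  obtain ⟨ρ, hρ, C, hC, est⟩ :=
    exists_solution_estimate hg_proper hvh hr h hcont hA3 hsub hA1 hmono hrσ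
  obtain ⟨η, hη, sol⟩ :=
    exists_solution hg_lsc hg_proper hvh hr h hcont hA3 hsub hA1 hmono hrσ hρ
  choose! ϑ hϑ hϑsol using sol
  have hκ : 0 < (σ - r) / 2 := by linarith
  refine ⟨(σ - r) / 2, hκ, 4 * ((σ - r) / 2) * C + 1, by positivity,
    ball vb (min ρ η), ball_mem_nhds _ (by positivity), ball pb (min ρ η),
    ball_mem_nhds _ (by positivity), ball qb (min ρ η), ball_mem_nhds _ (by positivity),
    ball xb ρ, ball_mem_nhds _ hρ, ϑ, ?_, ?_⟩
  · intro v hv p hp q hq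
    rw [mem_ball, lt_min_iff] at hv hp hq
    rw [dist_eq_norm] at hv
    have hθ := hϑ v p q hv.2 hp.2 hq.2
    have hθs := hϑsol v p q hv.2 hp.2 hq.2
    refine ⟨mem_ball_iff_norm.2 hθ, hθs, fun x hx hxs => ?_⟩
    have := est v p q x v p q _ hv.1 hp.1 hq.1 (mem_ball_iff_norm.1 hx) hxs hv.1 hp.1 hq.1 hθ hθs
    simp only [dist_self, sub_self, inner_zero_left] at this
    have h0 : ‖x - ϑ v p q‖ ^ 2 ≤ 0 := by nlinarith
    have h1 : ‖x - ϑ v p q‖ = 0 := pow_eq_zero_iff two_ne_zero |>.1 (h0.antisymm (sq_nonneg _))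
    exact sub_eq_zero.1 (norm_eq_zero.1 h1)
  · intro v₁ hv₁ p₁ hp₁ q₁ hq₁ v₂ hv₂ p₂ hp₂ q₂ hq₂
    rw [mem_ball, lt_min_iff] at hv₁ hp₁ hq₁ hv₂ hp₂ hq₂
    rw [dist_eq_norm] at hv₁ hv₂
    exact holder_norm_estimate hκ hC dist_nonneg dist_nonneg
      (est v₁ p₁ q₁ _ v₂ p₂ q₂ _ hv₁.1 hp₁.1 hq₁.1 (hϑ v₁ p₁ q₁ hv₁.2 hp₁.2 hq₁.2)
        (hϑsol v₁ p₁ q₁ hv₁.2 hp₁.2 hq₁.2) hv₂.1 hp₂.1 hq₂.1 (hϑ v₂ p₂ q₂ hv₂.2 hp₂.2 hq₂.2)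
        (hϑsol v₂ p₂ q₂ hv₂.2 hp₂.2 hq₂.2))

/-- quantitative condition for Hölderian full stability of smooth
PVS under strong monotonicity (Proposition 6.1). -/
theorem statement6
    {X : Type*} [NormedAddCommGroup X] [InnerProductSpace ℝ X] [CompleteSpace X]
    {P : Type*} [MetricSpace P] {Q : Type*} [MetricSpace Q]
    (f : X → P → Q → X) (Df : X → P → Q → X →L[ℝ] X) (g : X → P → EReal)
    (xb vb vh : X) (pb : P) (qb : Q)
    (hg_lsc : LowerSemicontinuous fun t : X × P => g t.1 t.2)
    (hg_proper : ∀ x p, g x p ≠ ⊥)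
    (hvh : vh = vb - f xb pb qb)
    (hsol : xb ∈ SolMap f g vb pb qb)
    (hA1 : A1 f xb pb qb) (hA2 : A2 g xb pb vh) (hA3 : A3 g xb pb)
    (hA4 : A4 f Df xb pb qb)
    (σ : ℝ) (hmono : StrongMono f xb pb qb σ)
    (hσ : proxThreshold g xb pb vh < σ) :
    (∀ r : ℝ, proxThreshold g xb pb vh < r → r < σ →
        ∃ η > (0:ℝ), SOC g (Df xb pb qb) xb pb vh η (σ - r)) ∧
      HolderFullStable (SolMap f g) xb vb pb qb := by
  have hsub : vh ∈ pSubdiff g xb pb := by rw [hvh]; exact hsol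
  refine ⟨fun r hr hrσ => ?_, ?_⟩
  · obtain ⟨hr0, hprox⟩ := proxRegWith_of_proxThreshold_lt hA2 hr
    exact exists_SOC hg_lsc hg_proper hr0.le hprox hA2.2 hA3 hsub (hmono.le_inner_deriv hA4)
  · obtain ⟨r, hr, hrσ⟩ := exists_between hσ
    obtain ⟨hr0, hprox⟩ := proxRegWith_of_proxThreshold_lt hA2 hr
    exact holderFullStable_of_strongMono hg_lsc hg_proper hvh hr0.le hprox hA2.2 hA3 hsub hA1
      hmono hrσ

end PVS
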